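/- Let k ≥ 2, s > 2k, C ≥ 2 and δ = 8^{−2k}. For real α with P^{1/3−k} < α ≤ 1, let M_α(C) be the set of λ ∈ Λ_k^{(s)}(C) with |f(λ_j α)| ≥ P^{1−11δ} for all 1 ≤ j ≤ s. Then the Lebesgue measure of M_α(C) is ≪ P^{(55δk − k)(s−1)}, uniformly for α in the range P^{1/3−k} < α ≤ 1, with an implicit constant depending only on k, s, C. -/

import Mathlib

open MeasureTheory

/-- e(t) = e^{2πit}. -/
noncomputable def eF (t : ℝ) : ℂ := Complex.exp (2 * Real.pi * Complex.I * t)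

/-- The Weyl sum f(α) = Σ_{x ∈ ℤ, |x| ≤ P} e(α x^k). -/
noncomputable def fW (k : ℕ) (P α : ℝ) : ℂ :=
  ∑ x ∈ Finset.Icc (-(⌊P⌋ : ℤ)) ⌊P⌋, eF (α * (x : ℝ) ^ k)

/-- δ = 8^{−2k}. -/
noncomputable def dlt (k : ℕ) : ℝ := ((8 : ℝ) ^ (2 * k))⁻¹

/-- Λ_k^{(s)}: s-tuples of nonzero reals; for even k additionally some λ_i λ_j < 0. -/
def Lam (k s : ℕ) : Set (Fin s → ℝ) :=
  {l | (∀ j, l j ≠ 0) ∧ (Even k → ∃ i j, l i * l j < 0)}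

/-- Λ_k^{(s)}(C) = {λ ∈ Λ_k^{(s)} : 1/C ≤ |λ_j| ≤ C}. -/
def LamC (k s : ℕ) (C : ℝ) : Set (Fin s → ℝ) :=
  {l | l ∈ Lam k s ∧ ∀ j, 1 / C ≤ |l j| ∧ |l j| ≤ C}

lemma eF_add (s t : ℝ) : eF (s + t) = eF s * eF t := by
  simp only [eF, ← Complex.exp_add]; congr 1; push_cast; ring

lemma eF_eq_exp_I (t : ℝ) : eF t = Complex.exp (Complex.I * ((2 * Real.pi * t : ℝ) : ℂ)) := by
  simp only [eF]; congr 1; push_cast; ring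

lemma norm_eF (t : ℝ) : ‖eF t‖ = 1 := by
  rw [eF_eq_exp_I, mul_comm]; exact Complex.norm_exp_ofReal_mul_I _

@[simp] lemma eF_zero : eF 0 = 1 := by simp [eF]

lemma eF_intCast (n : ℤ) : eF n = 1 := by
  simp only [eF]
  rw [Complex.exp_eq_one_iff]
  exact ⟨n, by push_cast; ring⟩

lemma eF_neg (t : ℝ) : eF (-t) = (starRingEnd ℂ) (eF t) := by
  simp only [eF, ← Complex.exp_conj]; congr 1; simp [Complex.conj_ofNat]

lemma eF_sub (s t : ℝ) : eF (s - t) = eF s * (starRingEnd ℂ) (eF t) := by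
  rw [sub_eq_add_neg, eF_add, eF_neg]

lemma norm_eF_sub_one_le (t : ℝ) : ‖eF t - 1‖ ≤ 2 * Real.pi * |t| := by
  rw [eF_eq_exp_I]
  refine Real.norm_exp_I_mul_ofReal_sub_one_le.trans_eq ?_
  rw [Real.norm_eq_abs, abs_mul, abs_of_pos (by positivity)]

lemma norm_eF_sub_eF_le (s t : ℝ) : ‖eF s - eF t‖ ≤ 2 * Real.pi * |s - t| := by
  have h : eF s - eF t = eF t * (eF (s - t) - 1) := by
    rw [mul_sub, ← eF_add]; simp
  rw [h, norm_mul, norm_eF, one_mul]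
  exact norm_eF_sub_one_le _

lemma le_norm_eF_sub_one {t : ℝ} (ht : |t| ≤ 1 / 2) : 4 * |t| ≤ ‖eF t - 1‖ := by
  rw [eF_eq_exp_I, Complex.norm_exp_I_mul_ofReal_sub_one]
  have h1 : 2 * Real.pi * t / 2 = Real.pi * t := by ring
  rw [h1, norm_mul, Real.norm_eq_abs, Real.norm_eq_abs, abs_two]
  have h2 : |Real.sin (Real.pi * t)| = Real.sin (Real.pi * |t|) := by
    rcases abs_cases t with ⟨h, h0⟩ | ⟨h, h0⟩
    · rw [h, abs_of_nonneg]
      refine Real.sin_nonneg_of_nonneg_of_le_pi (by positivity) ?_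
      nlinarith [Real.pi_pos]
    · rw [h, mul_neg, Real.sin_neg, abs_of_nonpos]
      refine Real.sin_nonpos_of_nonpos_of_neg_pi_le ?_ ?_ <;> nlinarith [Real.pi_pos]
  rw [h2]
  have h3 := Real.mul_le_sin (x := Real.pi * |t|) (by positivity) (by nlinarith [Real.pi_pos])
  have h4 : 2 / Real.pi * (Real.pi * |t|) = 2 * |t| := by
    field_simp
  linarith

/-- Distance from a real number to the nearest integer. -/
noncomputable def distInt (t : ℝ) : ℝ := |t - round t|

lemma le_norm_eF_sub_one_distInt (t : ℝ) : 4 * distInt t ≤ ‖eF t - 1‖ := by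
  have h := le_norm_eF_sub_one (abs_sub_round t)
  rw [sub_eq_add_neg, eF_add, ← Int.cast_neg, eF_intCast, mul_one, Int.cast_neg,
    ← sub_eq_add_neg] at h
  exact h

lemma norm_sum_eF_linear_le (γ c : ℝ) (m : ℕ) (h : 0 < distInt γ) :
    ‖∑ x ∈ Finset.range m, eF (γ * x + c)‖ ≤ 1 / (2 * distInt γ) := by
  have h4 := le_norm_eF_sub_one_distInt γ
  have hne : eF γ ≠ 1 := fun h0 ↦ by rw [h0, sub_self, norm_zero] at h4; linarith
  have hpow (x : ℕ) : eF (γ * x + c) = eF c * eF γ ^ x := by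
    rw [add_comm, eF_add]
    congr 1
    induction x with
    | zero => simp
    | succ n ih => rw [pow_succ, ← ih, ← eF_add]; congr 1; push_cast; ring
  simp_rw [hpow]
  rw [← Finset.mul_sum, norm_mul, norm_eF, one_mul, geom_sum_eq hne, norm_div]
  have h2 : ‖eF γ ^ m - 1‖ ≤ 2 := by
    refine (norm_sub_le _ _).trans ?_
    rw [norm_pow, norm_eF]; norm_num
  calc ‖eF γ ^ m - 1‖ / ‖eF γ - 1‖ ≤ 2 / (4 * distInt γ) := by gcongr
    _ = _ := by field_simp; norm_num

lemma norm_sum_eF_le (φ : ℕ → ℝ) (s : Finset ℕ) : ‖∑ x ∈ s, eF (φ x)‖ ≤ s.card := by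
  refine (norm_sum_le _ _).trans ?_
  simp [norm_eF]

/-- The Weyl majorant obtained by iterated differencing from a majorant `g` for linear phases. -/
noncomputable def weylMaj (L : ℕ) (g : ℝ → ℝ) : ℕ → ℝ → ℝ
  | 0, γ => g γ
  | j + 1, γ => ∑ h ∈ Finset.range L, weylMaj L g j ((j + 2 : ℝ) * h * γ)

lemma norm_sq_sum_eq (u : ℕ → ℂ) (hu : ∀ x, ‖u x‖ = 1) (m : ℕ) :
    ‖∑ x ∈ Finset.range m, u x‖ ^ 2 =
      2 * (∑ x ∈ Finset.range m, ∑ y ∈ Finset.range (x + 1),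
        u x * (starRingEnd ℂ) (u y)).re - m := by
  induction m with
  | zero => simp
  | succ m ih =>
    rw [Finset.sum_range_succ, Finset.sum_range_succ (n := m), Complex.add_re,
      Finset.sum_range_succ _ m, Complex.add_re, ← Finset.mul_sum, ← map_sum]
    set S := ∑ x ∈ Finset.range m, u x
    have h1 : (u m * (starRingEnd ℂ) (u m)).re = 1 := by
      rw [Complex.mul_conj, Complex.normSq_eq_norm_sq, hu]; simp
    have h2 : ‖S + u m‖ ^ 2 = ‖S‖ ^ 2 + 2 * (u m * (starRingEnd ℂ) S).re + 1 := by
      have e1 : ‖u m‖ ^ 2 = 1 := by rw [hu]; norm_num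
      rw [← e1, ← Complex.normSq_eq_norm_sq, ← Complex.normSq_eq_norm_sq,
        ← Complex.normSq_eq_norm_sq, add_comm S, Complex.normSq_add]
      ring
    rw [h1, h2, ih]
    push_cast; ring

lemma norm_sq_sum_le (u : ℕ → ℂ) (hu : ∀ x, ‖u x‖ = 1) (m : ℕ) :
    ‖∑ x ∈ Finset.range m, u x‖ ^ 2 ≤
      2 * ∑ h ∈ Finset.range m,
        ‖∑ y ∈ Finset.range (m - h), u (y + h) * (starRingEnd ℂ) (u y)‖ := by
  rw [norm_sq_sum_eq u hu]
  have h1 : ∑ x ∈ Finset.range m, ∑ y ∈ Finset.range (x + 1), u x * (starRingEnd ℂ) (u y) =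
      ∑ h ∈ Finset.range m, ∑ y ∈ Finset.range (m - h), u (y + h) * (starRingEnd ℂ) (u y) := by
    rw [← Finset.sum_range_diag_flip m (fun h y ↦ u (y + h) * (starRingEnd ℂ) (u y))]
    refine Finset.sum_congr rfl fun x _ ↦ ?_
    rw [← Finset.sum_range_reflect]
    refine Finset.sum_congr rfl fun y hy ↦ ?_
    have := Finset.mem_range.1 hy
    rw [show x + 1 - 1 - y = x - y by omega, show x - y + y = x by omega]
  rw [h1]
  have h2 := (Complex.re_le_norm (∑ h ∈ Finset.range m, ∑ y ∈ Finset.range (m - h),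
    u (y + h) * (starRingEnd ℂ) (u y))).trans (norm_sum_le _ _)
  have h3 : (0 : ℝ) ≤ m := Nat.cast_nonneg _
  linarith

lemma weylMaj_nonneg (L : ℕ) (g : ℝ → ℝ) (hg : ∀ t, 0 ≤ g t) (j : ℕ) (γ : ℝ) :
    0 ≤ weylMaj L g j γ := by
  induction j generalizing γ with
  | zero => exact hg γ
  | succ j ih => exact Finset.sum_nonneg fun h _ ↦ ih _

lemma weylMaj_le (L : ℕ) (g : ℝ → ℝ) (hg : ∀ t, g t ≤ L) (j : ℕ) (γ : ℝ) :
    weylMaj L g j γ ≤ (L : ℝ) ^ (j + 1) := by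
  induction j generalizing γ with
  | zero => simpa [weylMaj] using hg γ
  | succ j ih =>
    refine (Finset.sum_le_card_nsmul _ _ _ fun h _ ↦ ih _).trans_eq ?_
    simp [pow_succ]; ring

lemma pow_sum_le_card_mul {ι : Type*} (s : Finset ι) (f : ι → ℝ) (hf : ∀ i ∈ s, 0 ≤ f i) (n : ℕ) :
    (∑ i ∈ s, f i) ^ (n + 1) ≤ (s.card : ℝ) ^ n * ∑ i ∈ s, f i ^ (n + 1) := by
  rcases s.eq_empty_or_nonempty with rfl | hs
  · simp
  · have h := pow_sum_div_card_le_sum_pow (s := s) hf n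
    have hc : (0 : ℝ) < (s.card : ℝ) ^ n := by
      have := hs.card_pos
      positivity
    rw [div_le_iff₀ hc] at h
    linarith

open Polynomial in
lemma polynomial_shift_sub_coeff (φ : ℝ[X]) (j : ℕ) (hφ : φ.natDegree ≤ j + 1) (h : ℝ) :
    (φ.comp (X + C h) - φ).natDegree ≤ j ∧
      (φ.comp (X + C h) - φ).coeff j = (j + 1 : ℝ) * h * φ.coeff (j + 1) := by
  have e : φ.comp (X + C h) = taylor h φ := rfl
  rw [e]
  constructor
  · rw [natDegree_le_iff_coeff_eq_zero]
    intro N hN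
    rw [coeff_sub, taylor_coeff]
    rcases (Nat.succ_le_of_lt hN).eq_or_lt with h1 | h1
    · subst h1
      have : (hasseDeriv (j + 1) φ).natDegree ≤ 0 := by
        refine (natDegree_hasseDeriv_le _ _).trans (by omega)
      rw [eq_C_of_natDegree_le_zero this, eval_C, hasseDeriv_coeff]
      simp
    · have h3 : φ.natDegree < N := by omega
      rw [hasseDeriv_eq_zero_of_lt_natDegree _ _ h3, coeff_eq_zero_of_natDegree_lt h3]
      simp
  · rw [coeff_sub, taylor_coeff]
    have h1 : (hasseDeriv j φ).natDegree ≤ 1 := by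
      refine (natDegree_hasseDeriv_le _ _).trans (by omega)
    rw [eq_X_add_C_of_natDegree_le_one h1]
    simp only [eval_add, eval_mul, eval_C, eval_X, hasseDeriv_coeff]
    rw [zero_add, Nat.choose_self, add_comm 1 j, Nat.choose_succ_self_right]
    push_cast; ring

open Polynomial in
/-- Iterated Weyl differencing. -/
lemma weyl_differencing (L : ℕ) (g : ℝ → ℝ) (hg0 : ∀ t, 0 ≤ g t)
    (hg : ∀ (m : ℕ) (γ c : ℝ), m ≤ L → ‖∑ x ∈ Finset.range m, eF (γ * x + c)‖ ≤ g γ) (j : ℕ) :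
    ∀ (φ : ℝ[X]) (m : ℕ), φ.natDegree ≤ j + 1 → m ≤ L →
      ‖∑ x ∈ Finset.range m, eF (φ.eval (x : ℝ))‖ ^ (2 ^ j) ≤
        2 ^ (2 ^ j * j) * (L : ℝ) ^ (2 ^ j - (j + 1)) * weylMaj L g j (φ.coeff (j + 1)) := by
  intro φ m
  induction j generalizing φ m with
  | zero =>
    intro hφ hm
    have : ∀ x : ℕ, φ.eval (x : ℝ) = φ.coeff 1 * x + φ.coeff 0 := by
      intro x
      conv_lhs => rw [eq_X_add_C_of_natDegree_le_one (p := φ) (by simpa using hφ)]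
      simp
    simp_rw [this]
    simpa [weylMaj] using hg m _ _ hm
  | succ j ih =>
    intro hφ hm
    have hj : j + 1 ≤ 2 ^ j := Nat.lt_two_pow_self
    set T : ℕ → ℝ := fun h ↦ ‖∑ y ∈ Finset.range (m - h),
        eF (φ.eval ((y + h : ℕ) : ℝ)) * (starRingEnd ℂ) (eF (φ.eval (y : ℝ)))‖ with hT
    have h1 : ‖∑ x ∈ Finset.range m, eF (φ.eval (x : ℝ))‖ ^ 2 ≤ 2 * ∑ h ∈ Finset.range L, T h := by
      refine (norm_sq_sum_le (fun x ↦ eF (φ.eval (x : ℝ))) (fun x ↦ norm_eF _) m).trans ?_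
      gcongr
    have h2 : ∀ h, T h ^ (2 ^ j) ≤ 2 ^ (2 ^ j * j) * (L : ℝ) ^ (2 ^ j - (j + 1)) *
        weylMaj L g j ((j + 2 : ℝ) * h * φ.coeff (j + 2)) := by
      intro h
      have hs := polynomial_shift_sub_coeff φ (j + 1) hφ h
      have := ih (φ.comp (X + C (h : ℝ)) - φ) (m - h) hs.1 (by omega)
      rw [hs.2] at this
      simp only [hT]
      convert this using 4
      · rw [← eF_sub]; simp
      · push_cast; ring
    have h3 : (∑ h ∈ Finset.range L, T h) ^ (2 ^ j) ≤
        (L : ℝ) ^ (2 ^ j - 1) * ∑ h ∈ Finset.range L, T h ^ (2 ^ j) := by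
      have := pow_sum_le_card_mul (Finset.range L) T (fun i _ ↦ norm_nonneg _) (2 ^ j - 1)
      rwa [Finset.card_range, Nat.sub_add_cancel Nat.one_le_two_pow] at this
    calc ‖∑ x ∈ Finset.range m, eF (φ.eval (x : ℝ))‖ ^ (2 ^ (j + 1))
        = (‖∑ x ∈ Finset.range m, eF (φ.eval (x : ℝ))‖ ^ 2) ^ (2 ^ j) := by
          rw [← pow_mul]; congr 1; ring
      _ ≤ (2 * ∑ h ∈ Finset.range L, T h) ^ (2 ^ j) := by gcongr
      _ = 2 ^ (2 ^ j) * (∑ h ∈ Finset.range L, T h) ^ (2 ^ j) := mul_pow _ _ _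
      _ ≤ 2 ^ (2 ^ j) * ((L : ℝ) ^ (2 ^ j - 1) * ∑ h ∈ Finset.range L,
          2 ^ (2 ^ j * j) * (L : ℝ) ^ (2 ^ j - (j + 1)) *
            weylMaj L g j ((j + 2 : ℝ) * h * φ.coeff (j + 2))) := by
          refine mul_le_mul_of_nonneg_left (h3.trans ?_) (by positivity)
          gcongr with h _
          exact h2 h
      _ = 2 ^ (2 ^ j * j + 2 ^ j) * (L : ℝ) ^ ((2 ^ j - 1) + (2 ^ j - (j + 1))) *
          weylMaj L g (j + 1) (φ.coeff (j + 2)) := by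
          rw [← Finset.mul_sum, weylMaj]; ring
      _ ≤ _ := by
          have e1 : (2 ^ j - 1) + (2 ^ j - (j + 1)) = 2 ^ (j + 1) - (j + 1 + 1) := by
            rw [pow_succ]; omega
          rw [e1]
          have := weylMaj_nonneg L g hg0 (j + 1) (φ.coeff (j + 2))
          gcongr
          · norm_num
          · rw [pow_succ]; nlinarith

/-- A submultiplicative function that is `≪ (l + 1) p ^ (l σ)` on prime powers
is `≪ n ^ (σ + ε)`. -/
lemma exists_le_rpow_of_submultiplicative (f : ℕ → ℝ) (h1 : f 1 ≤ 1)
    (hf0 : ∀ n, 0 ≤ f n)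
    (hmul : ∀ m n : ℕ, m ≠ 0 → n ≠ 0 → m.Coprime n → f (m * n) ≤ f m * f n)
    {A σ : ℝ} (hA : 1 ≤ A)
    (hpp : ∀ p l : ℕ, p.Prime → l ≠ 0 → f (p ^ l) ≤ A * (l + 1) * ((p : ℝ) ^ l) ^ σ)
    {ε : ℝ} (hε : 0 < ε) :
    ∃ C : ℝ, 1 ≤ C ∧ ∀ n : ℕ, n ≠ 0 → f n ≤ C * (n : ℝ) ^ (σ + ε) := by
  set x : ℝ := 2 ^ ε - 1 with hx
  have hx0 : 0 < x := by
    have : (1 : ℝ) < 2 ^ ε := Real.one_lt_rpow (by norm_num) hε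
    linarith
  set B : ℝ := A * (1 + 1 / x) with hB
  have hB1 : 1 ≤ B := by
    have : 0 < 1 / x := by positivity
    nlinarith
  have hl (l : ℕ) : A * (l + 1) ≤ B * ((2 : ℝ) ^ ε) ^ l := by
    have hb := one_add_mul_le_pow (a := x) (by linarith) l
    rw [show 1 + x = 2 ^ ε by rw [hx]; ring] at hb
    have h2 : (l + 1 : ℝ) ≤ (1 + 1 / x) * (1 + l * x) := by
      have e : (1 + 1 / x) * (1 + l * x) = 1 + l + l * x + 1 / x := by field_simp; ring
      rw [e]
      have : 0 ≤ l * x + 1 / x := by positivity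
      linarith
    calc A * (l + 1) ≤ A * ((1 + 1 / x) * (1 + l * x)) := by gcongr
      _ ≤ A * ((1 + 1 / x) * (2 ^ ε) ^ l) := by gcongr
      _ = _ := by rw [hB]; ring
  obtain ⟨p₀, hp₀⟩ := exists_nat_ge ((2 * A) ^ (1 / ε))
  have hlarge (p l : ℕ) (hp : p₀ ≤ p) (hl0 : l ≠ 0) : A * (l + 1) ≤ ((p : ℝ) ^ l) ^ ε := by
    have h2 : 2 * A ≤ (p : ℝ) ^ ε := by
      have h3 : (2 * A) ^ (1 / ε) ≤ (p : ℝ) := hp₀.trans (by exact_mod_cast hp)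
      calc 2 * A = ((2 * A) ^ (1 / ε)) ^ ε := by
            rw [← Real.rpow_mul (by positivity), one_div_mul_cancel hε.ne', Real.rpow_one]
        _ ≤ _ := by gcongr
    have h4 : (l + 1 : ℝ) ≤ 2 ^ l := by exact_mod_cast Nat.lt_two_pow_self
    have h5 : A ≤ A ^ l := le_self_pow₀ hA hl0
    rw [← Real.rpow_natCast, ← Real.rpow_mul (by positivity), mul_comm (l : ℝ), Real.rpow_mul
      (by positivity), Real.rpow_natCast]
    calc A * (l + 1) ≤ A ^ l * 2 ^ l := by gcongr
      _ = (2 * A) ^ l := by rw [mul_pow]; ring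
      _ ≤ _ := by gcongr
  have key : ∀ n : ℕ, n ≠ 0 →
      f n ≤ B ^ (n.primeFactors.filter (· < p₀)).card * (n : ℝ) ^ (σ + ε) := by
    intro n
    induction n using Nat.recOnPosPrimePosCoprime with
    | prime_pow p l hp hl0 =>
      intro _
      have hppos : (0 : ℝ) < p := by exact_mod_cast hp.pos
      have h6 := hpp p l hp hl0.ne'
      push_cast
      rw [Nat.primeFactors_prime_pow hl0.ne' hp, Real.rpow_add (by positivity)]
      by_cases hlt : p < p₀
      · have e : ({p} : Finset ℕ).filter (· < p₀) = {p} := by simp [Finset.filter_singleton, hlt]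
        rw [e, Finset.card_singleton, pow_one]
        have h7 : ((2 : ℝ) ^ ε) ^ l ≤ ((p : ℝ) ^ l) ^ ε := by
          have h2p : (2 : ℝ) ≤ p := by exact_mod_cast hp.two_le
          rw [← Real.rpow_natCast (p : ℝ), ← Real.rpow_mul (by positivity), mul_comm (l : ℝ),
            Real.rpow_mul (by positivity), Real.rpow_natCast]
          gcongr
        calc f (p ^ l) ≤ A * (l + 1) * ((p : ℝ) ^ l) ^ σ := h6
          _ ≤ (B * ((2 : ℝ) ^ ε) ^ l) * ((p : ℝ) ^ l) ^ σ :=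
            mul_le_mul_of_nonneg_right (hl l) (by positivity)
          _ ≤ (B * ((p : ℝ) ^ l) ^ ε) * ((p : ℝ) ^ l) ^ σ := by gcongr
          _ = _ := by ring
      · have e : ({p} : Finset ℕ).filter (· < p₀) = ∅ := by simp [Finset.filter_singleton, hlt]
        rw [e, Finset.card_empty, pow_zero, one_mul]
        calc f (p ^ l) ≤ A * (l + 1) * ((p : ℝ) ^ l) ^ σ := h6
          _ ≤ ((p : ℝ) ^ l) ^ ε * ((p : ℝ) ^ l) ^ σ := by
            gcongr; exact hlarge p l (not_lt.1 hlt) hl0.ne'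
          _ = _ := by ring
    | zero => simp
    | one => intro _; simpa using h1
    | coprime a b ha hb hab iha ihb =>
      intro _
      have ha0 : a ≠ 0 := by omega
      have hb0 : b ≠ 0 := by omega
      rw [hab.primeFactors_mul, Finset.filter_union, Finset.card_union_of_disjoint, pow_add]
      · push_cast
        rw [Real.mul_rpow (by positivity) (by positivity)]
        calc f (a * b) ≤ f a * f b := hmul a b ha0 hb0 hab
          _ ≤ (B ^ (a.primeFactors.filter (· < p₀)).card * (a : ℝ) ^ (σ + ε)) *
              (B ^ (b.primeFactors.filter (· < p₀)).card * (b : ℝ) ^ (σ + ε)) :=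
            mul_le_mul (iha ha0) (ihb hb0) (hf0 _) (by positivity)
          _ = _ := by ring
      · exact Finset.disjoint_filter_filter hab.disjoint_primeFactors
  refine ⟨B ^ p₀, one_le_pow₀ hB1, fun n hn ↦ (key n hn).trans ?_⟩
  gcongr
  calc (n.primeFactors.filter (· < p₀)).card ≤ (Finset.range p₀).card := by
        refine Finset.card_le_card fun p hp ↦ ?_
        simpa using (Finset.mem_filter.1 hp).2
    _ = p₀ := Finset.card_range _

lemma exists_card_divisors_le_rpow {ε : ℝ} (hε : 0 < ε) :
    ∃ C : ℝ, 1 ≤ C ∧ ∀ n : ℕ, n ≠ 0 → (n.divisors.card : ℝ) ≤ C * (n : ℝ) ^ ε := by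
  have := exists_le_rpow_of_submultiplicative (fun n ↦ (n.divisors.card : ℝ)) (A := 1) (σ := 0)
    (by simp) (fun n ↦ Nat.cast_nonneg _)
    (fun m n _ _ h ↦ by
      rw [h.card_divisors_mul]; push_cast; exact le_rfl) le_rfl
    (fun p l hp _ ↦ by simp [Nat.divisors_prime_pow hp]) hε
  simpa using this

/-- The Weyl majorant is controlled by a sum over multiples, up to a divisor factor. -/
lemma exists_weylMaj_le (j : ℕ) {ε : ℝ} (hε : 0 < ε) :
    ∃ A : ℝ, 1 ≤ A ∧ ∀ (L : ℕ) (g : ℝ → ℝ) (γ : ℝ), 1 ≤ L → (∀ t, 0 ≤ g t) → (∀ t, g t ≤ L) →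
      weylMaj L g j γ ≤ A * (L : ℝ) ^ ε *
        ∑ n ∈ Finset.Icc 1 ((j + 1).factorial * L ^ j), g (n * γ) + A * (L : ℝ) ^ j := by
  induction j generalizing ε with
  | zero =>
    refine ⟨1, le_rfl, fun L g γ hL h0 h1 ↦ ?_⟩
    have hLε : (1 : ℝ) ≤ (L : ℝ) ^ ε := Real.one_le_rpow (by exact_mod_cast hL) hε.le
    have := h0 γ
    simp [weylMaj]
    nlinarith
  | succ j ih =>
    obtain ⟨A, hA, H⟩ := ih (half_pos hε)
    set η : ℝ := ε / (2 * (j + 1)) with hη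
    have hη0 : 0 < η := by positivity
    obtain ⟨D, hD, HD⟩ := exists_card_divisors_le_rpow hη0
    set F : ℝ := ((j + 2).factorial : ℝ) ^ η with hF
    have hF1 : 1 ≤ F := Real.one_le_rpow (by exact_mod_cast Nat.factorial_pos _) hη0.le
    have hA0 : 0 < A := by linarith
    have hD0 : 0 < D := by linarith
    refine ⟨A * D * F + A + 1, by nlinarith [mul_pos (mul_pos hA0 hD0) (zero_lt_one.trans_le hF1)],
      fun L g γ hL h0 h1 ↦ ?_⟩
    set M := (j + 1).factorial * L ^ j with hM
    set M' := (j + 1 + 1).factorial * L ^ (j + 1) with hM'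
    have hL0 : (0 : ℝ) < L := by exact_mod_cast hL
    -- the double sum over `h, n` is a sum over multiples weighted by divisors
    have hdouble : ∑ h ∈ Finset.Ico 1 L, ∑ n ∈ Finset.Icc 1 M, g (n * ((j + 2 : ℝ) * h * γ)) ≤
        D * F * (L : ℝ) ^ (ε / 2) * ∑ m ∈ Finset.Icc 1 M', g (m * γ) := by
      rw [← Finset.sum_product']
      have hmaps : ∀ z ∈ Finset.Ico 1 L ×ˢ Finset.Icc 1 M,
          (j + 2) * z.1 * z.2 ∈ Finset.Icc 1 M' := by
        rintro ⟨h, n⟩ hz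
        simp only [Finset.mem_product, Finset.mem_Ico, Finset.mem_Icc] at hz ⊢
        obtain ⟨⟨a1, a2⟩, a3, a4⟩ := hz
        constructor
        · exact Nat.succ_le_of_lt (by positivity)
        · calc (j + 2) * h * n ≤ (j + 2) * L * M := by gcongr
            _ = M' := by rw [hM, hM', Nat.factorial_succ (j + 1)]; ring
      rw [← Finset.sum_fiberwise_of_maps_to hmaps, Finset.mul_sum]
      refine Finset.sum_le_sum fun m hm ↦ ?_
      rw [Finset.mem_Icc] at hm
      have hm0 : m ≠ 0 := by omega
      have hterm : ∀ z ∈ (Finset.Ico 1 L ×ˢ Finset.Icc 1 M).filter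
          (fun z ↦ (j + 2) * z.1 * z.2 = m), g (z.2 * ((j + 2 : ℝ) * z.1 * γ)) = g (m * γ) := by
        rintro ⟨h, n⟩ hz
        rw [← (Finset.mem_filter.1 hz).2]
        congr 1; push_cast; ring
      rw [Finset.sum_congr rfl hterm, Finset.sum_const, nsmul_eq_mul]
      refine mul_le_mul_of_nonneg_right ?_ (h0 _)
      have hcard : ((Finset.Ico 1 L ×ˢ Finset.Icc 1 M).filter
          (fun z ↦ (j + 2) * z.1 * z.2 = m)).card ≤ m.divisors.card := by
        refine Finset.card_le_card_of_injOn (fun z ↦ z.1) ?_ ?_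
        · rintro ⟨h, n⟩ hz
          have := (Finset.mem_filter.1 hz).2
          simp only [Finset.mem_coe, Nat.mem_divisors]
          exact ⟨⟨(j + 2) * n, by rw [← this]; ring⟩, hm0⟩
        · rintro ⟨h, n⟩ hz ⟨h', n'⟩ hz' (rfl : h = h')
          have e1 := (Finset.mem_filter.1 hz).2
          have e2 := (Finset.mem_filter.1 hz').2
          have hh : 0 < h := by
            have := (Finset.mem_product.1 (Finset.mem_filter.1 hz).1).1
            exact (Finset.mem_Ico.1 this).1
          have e3 : (j + 2) * h * n = (j + 2) * h * n' := e1.trans e2.symm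
          have := Nat.eq_of_mul_eq_mul_left (by positivity) e3
          rw [this]
      calc _ ≤ (m.divisors.card : ℝ) := by exact_mod_cast hcard
        _ ≤ D * (m : ℝ) ^ η := HD m hm0
        _ ≤ D * (M' : ℝ) ^ η := by gcongr; exact hm.2
        _ = D * (F * (L : ℝ) ^ (ε / 2)) := by
          rw [hM']
          push_cast
          rw [Real.mul_rpow (by positivity) (by positivity), hF, ← Real.rpow_natCast (L : ℝ),
            ← Real.rpow_mul hL0.le]
          congr 3
          rw [hη]; push_cast; field_simp
        _ = _ := by ring
    have hS : 0 ≤ ∑ m ∈ Finset.Icc 1 M', g (m * γ) := Finset.sum_nonneg fun _ _ ↦ h0 _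
    rw [weylMaj, Finset.range_eq_Ico, Finset.sum_eq_sum_Ico_succ_bot (by omega)]
    have hzero := weylMaj_le L g h1 j ((j + 2 : ℝ) * (0 : ℕ) * γ)
    calc _ ≤ (L : ℝ) ^ (j + 1) + ∑ h ∈ Finset.Ico 1 L, (A * (L : ℝ) ^ (ε / 2) *
          ∑ n ∈ Finset.Icc 1 M, g (n * ((j + 2 : ℝ) * h * γ)) + A * (L : ℝ) ^ j) :=
          add_le_add hzero (Finset.sum_le_sum fun h _ ↦ H L g _ hL h0 h1)
      _ ≤ (L : ℝ) ^ (j + 1) + (A * (L : ℝ) ^ (ε / 2) *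
          (D * F * (L : ℝ) ^ (ε / 2) * ∑ m ∈ Finset.Icc 1 M', g (m * γ)) +
            L * (A * (L : ℝ) ^ j)) := by
          rw [Finset.sum_add_distrib, ← Finset.mul_sum, Finset.sum_const, nsmul_eq_mul,
            Nat.card_Ico]
          gcongr
          omega
      _ = A * D * F * (L : ℝ) ^ ε * (∑ m ∈ Finset.Icc 1 M', g (m * γ)) +
            (A + 1) * (L : ℝ) ^ (j + 1) := by
          have : (L : ℝ) ^ ε = (L : ℝ) ^ (ε / 2) * (L : ℝ) ^ (ε / 2) := by
            rw [← Real.rpow_add hL0]; congr 1; ring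
          rw [this]; ring
      _ ≤ _ := by
          have h3 : 0 ≤ A * D * F := by positivity
          gcongr <;> linarith

/-- Spacing count: few multiples of a real number with a good rational approximation of
denominator `q` are close to an integer. -/
lemma card_distInt_le (γ : ℝ) (a : ℤ) (q : ℕ) (hq : 0 < q) (hcop : IsCoprime a (q : ℤ))
    (hγ : |γ - a / q| ≤ 1 / (q : ℝ) ^ 2) (M : ℕ) (e : ℝ) (he : 0 ≤ e) :
    (((Finset.Icc 1 M).filter fun n : ℕ ↦ distInt (n * γ) ≤ e).card : ℝ) ≤
      (2 * M / q + 1) * (4 * q * e + 2) := by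
  have hq0 : (0 : ℝ) < q := by exact_mod_cast hq
  set b := q / 2 + 1 with hb
  set r : ℕ → ℤ := fun n ↦ ⌊2 * q * (n * γ - round (n * γ))⌋ with hr
  have hsep (n n' : ℕ) (hlt : n < n') (hle : n' - n ≤ q / 2) (z : ℤ) :
      1 / (2 * q) ≤ |((n' : ℝ) - n) * γ - z| := by
    set j := n' - n with hj
    have hjr : (n' : ℝ) - n = j := by rw [hj, Nat.cast_sub hlt.le]
    rw [hjr]
    have hj0 : 0 < j := by omega
    have h2j : 2 * (j : ℝ) ≤ q := by
      have : 2 * j ≤ q := by omega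
      exact_mod_cast this
    have h1 : (1 : ℝ) / q ≤ |(j * (a / q) - z : ℝ)| := by
      have e1 : (j * (a / q) - z : ℝ) = ((j * a - z * q : ℤ) : ℝ) / q := by
        push_cast; field_simp
      rw [e1, abs_div, abs_of_pos hq0]
      gcongr
      rw [← Int.cast_abs]
      have : (j * a - z * q : ℤ) ≠ 0 := by
        intro h0
        have hd : (q : ℤ) ∣ j * a := ⟨z, by linarith⟩
        have hd2 : (q : ℤ) ∣ j := hcop.symm.dvd_of_dvd_mul_right hd
        have hd3 : q ∣ j := by exact_mod_cast hd2
        have := Nat.le_of_dvd hj0 hd3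
        omega
      exact_mod_cast Int.one_le_abs this
    have h2 : |(j : ℝ) * (γ - a / q)| ≤ 1 / (2 * q) := by
      rw [abs_mul, abs_of_nonneg (Nat.cast_nonneg j)]
      calc (j : ℝ) * |γ - a / q| ≤ (q / 2) * (1 / (q : ℝ) ^ 2) := by
            gcongr; linarith
        _ = _ := by field_simp
    have h3 : (j * (a / q) - z : ℝ) = (j * γ - z) - j * (γ - a / q) := by ring
    have h4 := abs_sub (j * γ - z) (j * (γ - a / q))
    rw [← h3] at h4
    have h5 : (1 : ℝ) / q = 1 / (2 * q) + 1 / (2 * q) := by field_simp; norm_num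
    linarith
  have hinj : Set.InjOn (fun n ↦ (n / b, r n))
      ((Finset.Icc 1 M).filter fun n : ℕ ↦ distInt (n * γ) ≤ e : Finset ℕ) := by
    have main : ∀ n n' : ℕ, n < n' → (n / b, r n) = (n' / b, r n') → False := by
      intro n n' hlt heq
      obtain ⟨h1, h2⟩ := Prod.mk.inj heq
      have hdiff : n' - n ≤ q / 2 := by
        have e1 := Nat.div_add_mod n b
        have e2 := Nat.div_add_mod n' b
        have e3 := Nat.mod_lt n' (show 0 < b by omega)
        rw [h1] at e1
        omega
      have h3 := Int.abs_sub_lt_one_of_floor_eq_floor h2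
      have h4 := hsep n n' hlt hdiff (round (n' * γ) - round (n * γ))
      have e4 : 2 * (q : ℝ) * (n * γ - round (n * γ)) - 2 * q * (n' * γ - round (n' * γ)) =
          -(2 * q * (((n' : ℝ) - n) * γ - ((round (n' * γ) - round (n * γ) : ℤ) : ℝ))) := by
        push_cast; ring
      rw [e4, abs_neg, abs_mul, abs_of_pos (by positivity)] at h3
      rw [div_le_iff₀ (by positivity)] at h4
      linarith
    intro n _ n' _ heq
    rcases lt_trichotomy n n' with h | h | h
    · exact (main n n' h heq).elim
    · exact h
    · exact (main n' n h heq.symm).elim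
  have hmaps : ∀ n ∈ (Finset.Icc 1 M).filter (fun n : ℕ ↦ distInt (n * γ) ≤ e),
      (n / b, r n) ∈ Finset.range (M / b + 1) ×ˢ
        Finset.Icc (-⌊2 * q * e⌋ - 1) ⌊2 * q * e⌋ := by
    intro n hn
    rw [Finset.mem_filter, Finset.mem_Icc] at hn
    obtain ⟨⟨_, hnM⟩, hd⟩ := hn
    rw [Finset.mem_product, Finset.mem_range, Finset.mem_Icc]
    refine ⟨Nat.lt_succ_of_le (Nat.div_le_div_right hnM), ?_, ?_⟩
    · rw [Int.le_floor]
      have := (abs_le.1 hd).1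
      have h1 := Int.lt_floor_add_one (2 * q * e)
      push_cast
      nlinarith
    · refine Int.floor_le_floor ?_
      have := (abs_le.1 hd).2
      gcongr
  have hcard := Finset.card_le_card_of_injOn _ hmaps hinj
  rw [Finset.card_product, Finset.card_range, Int.card_Icc] at hcard
  have hfl : 0 ≤ ⌊2 * q * e⌋ := Int.floor_nonneg.2 (by positivity)
  have h1 : ((M / b + 1 : ℕ) : ℝ) ≤ 2 * M / q + 1 := by
    push_cast
    have : ((M / b : ℕ) : ℝ) ≤ M / b := Nat.cast_div_le
    have hb2 : (q : ℝ) ≤ 2 * b := by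
      have : q ≤ 2 * b := by omega
      exact_mod_cast this
    have : (M : ℝ) / b ≤ 2 * M / q := by
      rw [div_le_div_iff₀ (by positivity) hq0]
      have : (0 : ℝ) ≤ M := Nat.cast_nonneg _
      nlinarith
    linarith
  have h2 : (((⌊2 * q * e⌋ + 1 - (-⌊2 * q * e⌋ - 1)).toNat : ℕ) : ℝ) ≤ 4 * q * e + 2 := by
    have h3 : (((⌊2 * q * e⌋ + 1 - (-⌊2 * q * e⌋ - 1)).toNat : ℕ) : ℝ) =
        ((2 * ⌊2 * q * e⌋ + 2 : ℤ) : ℝ) := by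
      have : (((⌊2 * q * e⌋ + 1 - (-⌊2 * q * e⌋ - 1)).toNat : ℕ) : ℤ) = 2 * ⌊2 * q * e⌋ + 2 := by
        omega
      exact_mod_cast this
    rw [h3]
    push_cast
    have := Int.floor_le (2 * q * e)
    linarith
  calc _ ≤ (((M / b + 1) * (⌊2 * q * e⌋ + 1 - (-⌊2 * q * e⌋ - 1)).toNat : ℕ) : ℝ) := by
        exact_mod_cast hcard
    _ = ((M / b + 1 : ℕ) : ℝ) * ((⌊2 * q * e⌋ + 1 - (-⌊2 * q * e⌋ - 1)).toNat : ℕ) := by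
        push_cast; ring
    _ ≤ _ := by gcongr

/-- The one-sided Weyl sum `∑_{0 ≤ x < n} e(γ x ^ k)`. -/
noncomputable def weylSum (k n : ℕ) (γ : ℝ) : ℂ := ∑ x ∈ Finset.range n, eF (γ * (x : ℝ) ^ k)

lemma norm_weylSum_le (k n : ℕ) (γ : ℝ) : ‖weylSum k n γ‖ ≤ n := by
  simpa [weylSum] using norm_sum_eF_le (fun x ↦ γ * (x : ℝ) ^ k) (Finset.range n)

lemma norm_weylSum_neg (k n : ℕ) (γ : ℝ) : ‖weylSum k n (-γ)‖ = ‖weylSum k n γ‖ := by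
  simp only [weylSum, neg_mul, eF_neg, ← map_sum, RCLike.norm_conj]

lemma exists_nat_forall_le_rpow (K : ℝ) {ε : ℝ} (hε : 0 < ε) :
    ∃ n₀ : ℕ, 2 ≤ n₀ ∧ ∀ n : ℕ, n₀ ≤ n → K < (n : ℝ) ^ ε := by
  have h := ((tendsto_rpow_atTop hε).comp tendsto_natCast_atTop_atTop).eventually_gt_atTop K
  obtain ⟨n₀, hn₀⟩ := Filter.eventually_atTop.1 h
  exact ⟨max 2 n₀, le_max_left _ _, fun n hn ↦ hn₀ n ((le_max_right _ _).trans hn)⟩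

open Polynomial in
/-- Weyl's inequality in the form of a lower bound for the differenced majorant. -/
lemma weylSum_pow_le (j n : ℕ) (g : ℝ → ℝ) (hg0 : ∀ t, 0 ≤ g t)
    (hg : ∀ (m : ℕ) (γ c : ℝ), m ≤ n → ‖∑ x ∈ Finset.range m, eF (γ * x + c)‖ ≤ g γ) (γ : ℝ) :
    ‖weylSum (j + 1) n γ‖ ^ (2 ^ j) ≤
        2 ^ (2 ^ j * j) * (n : ℝ) ^ (2 ^ j - (j + 1)) * weylMaj n g j γ := by
  have h := weyl_differencing n g hg0 hg j (C γ * X ^ (j + 1)) n (natDegree_C_mul_X_pow_le _ _)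
    le_rfl
  simpa [weylSum] using h

set_option maxHeartbeats 1000000 in
/-- If a Weyl sum is large then its argument is close to a rational of small denominator. -/
lemma exists_approx_of_weylSum_large (k : ℕ) (hk : 2 ≤ k) {τ : ℝ}
    (hτ : 2 ^ (k - 1) * τ ≤ 1 / 40) :
    ∃ n₀ : ℕ, ∀ (n : ℕ) (γ : ℝ), n₀ ≤ n → (n : ℝ) ^ (1 - τ) ≤ ‖weylSum k n γ‖ →
      ∃ (q : ℕ) (a : ℤ), 0 < q ∧ IsCoprime a (q : ℤ) ∧ (q : ℝ) ≤ (n : ℝ) ^ (1 / 8 : ℝ) ∧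
        q * |γ - a / q| ≤ (n : ℝ) ^ (1 / 8 - k : ℝ) := by
  obtain ⟨j, rfl⟩ : ∃ j, k = j + 1 := ⟨k - 1, by omega⟩
  rw [Nat.add_sub_cancel] at hτ
  obtain ⟨A, hA, HA⟩ := exists_weylMaj_le j (ε := 1 / 80) (by norm_num)
  set c : ℝ := 2 ^ (2 ^ j * j) with hc
  have hc0 : 0 < c := by positivity
  set f : ℝ := ((j + 1).factorial : ℝ) with hf
  have hf1 : 1 ≤ f := by
    rw [hf]; exact_mod_cast Nat.factorial_pos (j + 1)
  obtain ⟨n₀, hn₀2, hn₀⟩ := exists_nat_forall_le_rpow (c * (A * (13 * f + 6) + A))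
    (ε := 1 / 80) (by norm_num)
  have hA0 : 0 ≤ A := by linarith
  refine ⟨n₀, fun n γ hn hlarge ↦ ?_⟩
  have hn2 : 2 ≤ n := hn₀2.trans hn
  have hx1 : (1 : ℝ) ≤ n := by exact_mod_cast (by omega : 1 ≤ n)
  set x : ℝ := (n : ℝ) with hx
  have hx0 : 0 < x := by linarith
  have hj1 : (1 : ℝ) ≤ j := by exact_mod_cast (by omega : 1 ≤ j)
  set e : ℝ := x ^ (-1 + 1 / 20 : ℝ) with he
  have he0 : 0 < e := by positivity
  have hinve : 1 / e = x ^ (1 - 1 / 20 : ℝ) := by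
    rw [he, one_div, ← Real.rpow_neg hx0.le]; congr 1; ring
  set g : ℝ → ℝ := fun t ↦ if distInt t ≤ e then x else 1 / (2 * e) with hgdef
  have hg0 (t : ℝ) : 0 ≤ g t := by simp only [hgdef]; split_ifs <;> positivity
  have hex : 1 / (2 * e) ≤ x := by
    have : x ^ (1 - 1 / 20 : ℝ) ≤ x ^ (1 : ℝ) := Real.rpow_le_rpow_of_exponent_le hx1 (by norm_num)
    rw [Real.rpow_one, ← hinve] at this
    calc 1 / (2 * e) = (1 / e) / 2 := by field_simp
      _ ≤ _ := by linarith
  have hgx (t : ℝ) : g t ≤ x := by simp only [hgdef]; split_ifs <;> [exact le_rfl; exact hex]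
  have hg (m : ℕ) (γ c : ℝ) (hm : m ≤ n) :
      ‖∑ x ∈ Finset.range m, eF (γ * x + c)‖ ≤ g γ := by
    simp only [hgdef]
    split_ifs with h
    · refine (norm_sum_eF_le _ _).trans ?_
      rw [Finset.card_range, hx]; exact_mod_cast hm
    · rw [not_le] at h
      refine (norm_sum_eF_linear_le γ c m (he0.trans h)).trans ?_
      gcongr
  -- lower bound for the majorant
  have hlow : x ^ (j + 1 - 1 / 40 : ℝ) ≤ c * weylMaj n g j γ := by
    have h1 := weylSum_pow_le j n g hg0 hg γ
    have h2 : x ^ (2 ^ j - 1 / 40 : ℝ) ≤ ‖weylSum (j + 1) n γ‖ ^ (2 ^ j) := by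
      calc x ^ (2 ^ j - 1 / 40 : ℝ) ≤ x ^ ((1 - τ) * (2 ^ j : ℕ)) := by
            refine Real.rpow_le_rpow_of_exponent_le hx1 ?_
            push_cast; linarith
        _ = (x ^ (1 - τ)) ^ (2 ^ j) := by rw [Real.rpow_mul hx0.le, Real.rpow_natCast]
        _ ≤ _ := by gcongr
    have hj2 : j + 1 ≤ 2 ^ j := Nat.lt_two_pow_self
    have h3 : x ^ (j + 1 - 1 / 40 : ℝ) * x ^ (2 ^ j - (j + 1) : ℕ) = x ^ (2 ^ j - 1 / 40 : ℝ) := by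
      rw [← Real.rpow_natCast x, ← Real.rpow_add hx0, Nat.cast_sub hj2]
      congr 1; push_cast; ring
    rw [← mul_le_mul_iff_left₀ (show 0 < x ^ (2 ^ j - (j + 1) : ℕ) by positivity), h3]
    calc _ ≤ _ := h2.trans h1
      _ = _ := by ring
  -- Dirichlet approximation
  set Q : ℕ := ⌊x ^ (j + 1 - 1 / 10 : ℝ)⌋₊ with hQ
  have hQ0 : 0 < Q := Nat.floor_pos.2 (Real.one_le_rpow hx1 (by linarith))
  obtain ⟨r, hr1, hr2⟩ := Real.exists_rat_abs_sub_le_and_den_le γ hQ0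
  set q := r.den with hq
  have hq0 : (0 : ℝ) < q := by exact_mod_cast r.den_pos
  have hrq : (r : ℝ) = (r.num : ℝ) / q := by exact_mod_cast (Rat.num_div_den r).symm
  rw [hrq] at hr1
  have hcop : IsCoprime r.num (q : ℤ) := by
    rw [Int.isCoprime_iff_nat_coprime]; simpa using r.reduced
  have hQx : (q : ℝ) ≤ x ^ (j + 1 - 1 / 10 : ℝ) :=
    (Nat.cast_le.2 hr2).trans (Nat.floor_le (by positivity))
  have hQx' : x ^ (j + 1 - 1 / 10 : ℝ) ≤ Q + 1 := (Nat.lt_floor_add_one _).le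
  refine ⟨q, r.num, r.den_pos, hcop, ?_, ?_⟩
  swap
  · calc q * |γ - r.num / q| ≤ q * (1 / ((Q + 1) * q)) := by gcongr
      _ = 1 / (Q + 1) := by field_simp
      _ ≤ 1 / x ^ (j + 1 - 1 / 10 : ℝ) := by gcongr
      _ = x ^ (-(j + 1 - 1 / 10) : ℝ) := by rw [Real.rpow_neg hx0.le, one_div]
      _ ≤ _ := by
        refine Real.rpow_le_rpow_of_exponent_le hx1 ?_
        push_cast; linarith
  · by_contra! hqbig
    have hγ : |γ - r.num / q| ≤ 1 / (q : ℝ) ^ 2 := by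
      refine hr1.trans ?_
      rw [sq]
      have : (q : ℝ) ≤ Q := by exact_mod_cast hr2
      gcongr
      linarith
    set M := (j + 1).factorial * n ^ j with hM
    have hcount := card_distInt_le γ r.num q r.den_pos hcop hγ M e he0.le
    set N := ((Finset.Icc 1 M).filter fun n : ℕ ↦ distInt (n * γ) ≤ e).card with hN
    have hMx : (M : ℝ) = f * x ^ (j : ℝ) := by
      rw [hM, Real.rpow_natCast]; push_cast; rfl
    have hsum : ∑ m ∈ Finset.Icc 1 M, g (m * γ) ≤ x * N + M * (1 / (2 * e)) := by
      simp only [hgdef]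
      rw [Finset.sum_ite, Finset.sum_const, Finset.sum_const, nsmul_eq_mul, nsmul_eq_mul, ← hN,
        mul_comm x]
      gcongr
      refine (Finset.card_filter_le _ _).trans ?_
      simp
    have hup := HA n g γ (by omega) hg0 hgx
    rw [← hM, ← hx] at hup
    set B : ℝ := x ^ (j + 1 - 1 / 20 : ℝ) with hB
    have hpow {u : ℝ} (hu : u ≤ j + 1 - 1 / 20) : x ^ u ≤ B :=
      Real.rpow_le_rpow_of_exponent_le hx1 hu
    have b1 : x * (8 * M * e) ≤ 8 * f * B := by
      have : x * (8 * M * e) = 8 * f * x ^ (1 + j + (-1 + 1 / 20) : ℝ) := by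
        rw [hMx, Real.rpow_add hx0 _ (-1 + 1 / 20), ← he, Real.rpow_add hx0, Real.rpow_one]; ring
      rw [this]
      gcongr
      exact hpow (by linarith)
    have b2 : x * (4 * M / q) ≤ 4 * f * B := by
      have : x * (4 * M / q) ≤ 4 * f * x ^ (1 + j + -(1 / 8) : ℝ) := by
        calc x * (4 * M / q) ≤ x * (4 * M / x ^ (1 / 8 : ℝ)) := by gcongr
          _ = _ := by
            rw [hMx, Real.rpow_add hx0, Real.rpow_add hx0, Real.rpow_one, Real.rpow_neg hx0.le]
            field_simp
      refine this.trans ?_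
      gcongr
      exact hpow (by linarith)
    have b3 : x * (4 * q * e) ≤ 4 * B := by
      calc x * (4 * q * e) ≤ x * (4 * x ^ (j + 1 - 1 / 10 : ℝ) * e) := by gcongr
        _ = 4 * x ^ (1 + (j + 1 - 1 / 10) + (-1 + 1 / 20) : ℝ) := by
          rw [Real.rpow_add hx0 _ (-1 + 1 / 20), ← he, Real.rpow_add hx0, Real.rpow_one]; ring
        _ ≤ 4 * B := by gcongr; exact hpow (by linarith)
    have b4 : x * 2 ≤ 2 * B := by
      have : x ^ (1 : ℝ) ≤ B := hpow (by linarith)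
      rw [Real.rpow_one] at this; linarith
    have b5 : M * (1 / (2 * e)) ≤ f * B := by
      have : M * (1 / (2 * e)) = f * x ^ (j + (1 - 1 / 20) : ℝ) / 2 := by
        rw [Real.rpow_add hx0, ← hinve, hMx]; field_simp
      rw [this]
      have h1 : x ^ (j + (1 - 1 / 20) : ℝ) ≤ B := hpow (by linarith)
      have h2 : 0 ≤ B := by positivity
      nlinarith
    have hS : ∑ m ∈ Finset.Icc 1 M, g (m * γ) ≤ (13 * f + 6) * B := by
      have : x * N ≤ x * ((2 * M / q + 1) * (4 * q * e + 2)) := by gcongr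
      have e1 : x * ((2 * M / q + 1) * (4 * q * e + 2)) =
          x * (8 * M * e) + x * (4 * M / q) + x * (4 * q * e) + x * 2 := by
        field_simp; ring
      linarith
    have hfin : x ^ (j + 1 - 1 / 40 : ℝ) ≤
        (c * (A * (13 * f + 6) + A)) * x ^ (j + 1 - 1 / 20 + 1 / 80 : ℝ) := by
      have hjx : (x : ℝ) ^ j ≤ x ^ (j + 1 - 1 / 20 + 1 / 80 : ℝ) := by
        rw [← Real.rpow_natCast]
        exact Real.rpow_le_rpow_of_exponent_le hx1 (by linarith)
      have h80 : x ^ (1 / 80 : ℝ) * B = x ^ (j + 1 - 1 / 20 + 1 / 80 : ℝ) := by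
        rw [hB, ← Real.rpow_add hx0]; congr 1; ring
      have hmaj := mul_le_mul_of_nonneg_left hS
        (show 0 ≤ A * x ^ (1 / 80 : ℝ) from mul_nonneg hA0 (Real.rpow_nonneg hx0.le _))
      have hmaj' := mul_le_mul_of_nonneg_left hjx hA0
      have hmaj'' := mul_le_mul_of_nonneg_left (hup.trans (add_le_add hmaj hmaj')) hc0.le
      refine hlow.trans (hmaj''.trans (le_of_eq ?_))
      rw [← h80]
      ring
    have hcontra := hn₀ n hn
    have e2 : x ^ (j + 1 - 1 / 40 : ℝ) = x ^ (1 / 80 : ℝ) * x ^ (j + 1 - 1 / 20 + 1 / 80 : ℝ) := by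
      rw [← Real.rpow_add hx0]; congr 1; ring
    rw [e2] at hfin
    exact absurd (le_of_mul_le_mul_right hfin (by positivity)) (not_le.2 hcontra)

/-- The Kusmin–Landau inequality for monotone differences in `(0, 1 / 2]`. -/
lemma norm_sum_eF_le_of_monotone_sub (φ : ℕ → ℝ) (n : ℕ)
    (hmono : ∀ x, φ (x + 1) - φ x ≤ φ (x + 2) - φ (x + 1)) (h0 : 0 < φ 1 - φ 0)
    (h1 : ∀ x < n, φ (x + 1) - φ x ≤ 1 / 2) :
    ‖∑ x ∈ Finset.range n, eF (φ x)‖ ≤ 1 / (φ 1 - φ 0) := by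
  set Δ : ℕ → ℝ := fun x ↦ φ (x + 1) - φ x with hΔ
  have hm : Monotone Δ := monotone_nat_of_le_succ hmono
  have hpos (x : ℕ) : 0 < Δ x := lt_of_lt_of_le h0 (hm (Nat.zero_le x))
  have hlow (x : ℕ) (hx : x < n) : 4 * Δ x ≤ ‖eF (Δ x) - 1‖ := by
    have := le_norm_eF_sub_one (t := Δ x) (by rw [abs_of_pos (hpos x)]; exact h1 x hx)
    rwa [abs_of_pos (hpos x)] at this
  have hne (x : ℕ) (hx : x < n) : eF (Δ x) - 1 ≠ 0 :=
    norm_pos_iff.1 (lt_of_lt_of_le (mul_pos (by norm_num) (hpos x)) (hlow x hx))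
  have hg (x : ℕ) (hx : x < n) : ‖(eF (Δ x) - 1)⁻¹‖ ≤ 1 / (4 * Δ x) := by
    rw [norm_inv, ← one_div]
    exact one_div_le_one_div_of_le (mul_pos (by norm_num) (hpos x)) (hlow x hx)
  have hstep (x : ℕ) : eF (φ (x + 1)) = eF (Δ x) * eF (φ x) := by
    rw [← eF_add]; congr 1; simp [hΔ]
  have key (m : ℕ) (hmn : m < n) :
      ‖∑ x ∈ Finset.range (m + 1), eF (φ x) - (eF (Δ m) - 1)⁻¹ * eF (φ (m + 1))‖ ≤
        1 / (4 * Δ 0) + Real.pi / 8 * (1 / Δ 0 - 1 / Δ m) := by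
    induction m with
    | zero =>
      have : ∑ x ∈ Finset.range (0 + 1), eF (φ x) - (eF (Δ 0) - 1)⁻¹ * eF (φ (0 + 1)) =
          -((eF (Δ 0) - 1)⁻¹ * eF (φ 0)) := by
        rw [hstep]
        have := hne 0 hmn
        simp only [zero_add, Finset.sum_range_one]
        field_simp
        ring
      rw [this, norm_neg, norm_mul, norm_eF, mul_one]
      simpa using hg 0 hmn
    | succ m ih =>
      have hm' : m < n := by omega
      have e : ∑ x ∈ Finset.range (m + 1 + 1), eF (φ x) -
            (eF (Δ (m + 1)) - 1)⁻¹ * eF (φ (m + 1 + 1)) =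
          (∑ x ∈ Finset.range (m + 1), eF (φ x) - (eF (Δ m) - 1)⁻¹ * eF (φ (m + 1))) +
            (eF (Δ (m + 1)) - eF (Δ m)) * (eF (Δ m) - 1)⁻¹ * (eF (Δ (m + 1)) - 1)⁻¹ *
              eF (φ (m + 1)) := by
        rw [Finset.sum_range_succ, hstep (m + 1)]
        have := hne m hm'
        have := hne (m + 1) hmn
        field_simp
        ring
      rw [e]
      refine (norm_add_le _ _).trans ?_
      have hd : ‖(eF (Δ (m + 1)) - eF (Δ m)) * (eF (Δ m) - 1)⁻¹ * (eF (Δ (m + 1)) - 1)⁻¹ *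
          eF (φ (m + 1))‖ ≤ Real.pi / 8 * (1 / Δ m - 1 / Δ (m + 1)) := by
        rw [norm_mul, norm_mul, norm_mul, norm_eF, mul_one]
        have hle : Δ m ≤ Δ (m + 1) := hm (Nat.le_succ m)
        have h1 := norm_eF_sub_eF_le (Δ (m + 1)) (Δ m)
        rw [abs_of_nonneg (sub_nonneg.2 hle)] at h1
        have p1 := hpos m
        have p2 := hpos (m + 1)
        calc _ ≤ 2 * Real.pi * (Δ (m + 1) - Δ m) * (1 / (4 * Δ m)) * (1 / (4 * Δ (m + 1))) := by
              have := hg m hm'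
              have := hg (m + 1) hmn
              gcongr
          _ = _ := by field_simp; ring
      have := ih hm'
      linarith
  obtain rfl | ⟨m, rfl⟩ : n = 0 ∨ ∃ m, n = m + 1 := by
    rcases n with _ | m <;> simp
  · simpa using h0.le
  have h := key m (Nat.lt_succ_self m)
  have h' := hg m (Nat.lt_succ_self m)
  have hle : 1 / (4 * Δ m) ≤ 1 / (4 * Δ 0) :=
    one_div_le_one_div_of_le (mul_pos (by norm_num) (hpos 0))
      (mul_le_mul_of_nonneg_left (hm (Nat.zero_le m)) (by norm_num))
  have h4 : 1 / (4 * Δ 0) = (1 / Δ 0) / 4 := by have := (hpos 0).ne'; field_simp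
  have hpi : Real.pi / 8 * (1 / Δ 0 - 1 / Δ m) ≤ 1 / 2 * (1 / Δ 0) := by
    have a1 : 0 < 1 / Δ m := one_div_pos.2 (hpos m)
    have a2 : 0 < 1 / Δ 0 := one_div_pos.2 (hpos 0)
    have a3 := Real.pi_lt_four
    have a4 := Real.pi_pos
    nlinarith
  have htri := norm_add_le
    (∑ x ∈ Finset.range (m + 1), eF (φ x) - (eF (Δ m) - 1)⁻¹ * eF (φ (m + 1)))
    ((eF (Δ m) - 1)⁻¹ * eF (φ (m + 1)))
  rw [sub_add_cancel, norm_mul _ (eF (φ (m + 1))), norm_eF, mul_one] at htri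
  have : Δ 0 = φ 1 - φ 0 := rfl
  rw [← this]
  linarith

lemma add_one_pow_sub_pow (k : ℕ) (x : ℝ) :
    (x + 1) ^ k - x ^ k = ∑ i ∈ Finset.range k, (x + 1) ^ i * x ^ (k - 1 - i) := by
  have := (Commute.all (x + 1) x).geom_sum₂_mul k
  rw [← this]; ring

lemma add_one_pow_sub_pow_mono (k : ℕ) {x y : ℝ} (hx : 0 ≤ x) (hxy : x ≤ y) :
    (x + 1) ^ k - x ^ k ≤ (y + 1) ^ k - y ^ k := by
  have hy : 0 ≤ y := hx.trans hxy
  rw [add_one_pow_sub_pow, add_one_pow_sub_pow]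
  gcongr

lemma le_add_one_pow_sub_pow (k : ℕ) (hk : 1 ≤ k) {x : ℝ} (hx : 0 ≤ x) :
    x ^ (k - 1) ≤ (x + 1) ^ k - x ^ k := by
  rw [add_one_pow_sub_pow]
  refine (Finset.single_le_sum (f := fun i ↦ (x + 1) ^ i * x ^ (k - 1 - i))
    (fun i _ ↦ by positivity) (Finset.mem_range.2 hk)).trans' ?_
  simp

lemma add_one_pow_sub_pow_le (k : ℕ) {x : ℝ} (hx : 0 ≤ x) :
    (x + 1) ^ k - x ^ k ≤ k * (x + 1) ^ (k - 1) := by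
  rw [add_one_pow_sub_pow]
  refine (Finset.sum_le_card_nsmul _ _ ((x + 1) ^ (k - 1)) fun i hi ↦ ?_).trans_eq (by simp)
  rw [Finset.mem_range] at hi
  calc (x + 1) ^ i * x ^ (k - 1 - i) ≤ (x + 1) ^ i * (x + 1) ^ (k - 1 - i) := by
        gcongr; linarith
    _ = _ := by rw [← pow_add]; congr 1; omega

/-- Decay of Weyl sums close to the origin. -/
lemma norm_weylSum_le_of_small (k n : ℕ) (hk : 2 ≤ k) {β : ℝ} (hβ : β ≠ 0)
    (h : |β| * (k * (n : ℝ) ^ (k - 1)) ≤ 1 / 2) :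
    ‖weylSum k n β‖ ≤ 3 * |β| ^ (-(1 / k) : ℝ) := by
  wlog hpos : 0 < β generalizing β
  · have := this (neg_ne_zero.2 hβ) (by rwa [abs_neg])
      (by have := lt_of_le_of_ne (not_lt.1 hpos) hβ; linarith)
    rwa [norm_weylSum_neg, abs_neg] at this
  rw [abs_of_pos hpos] at h ⊢
  have hk0 : (0 : ℝ) < k := by positivity
  set T : ℝ := β ^ (-(1 / k) : ℝ) with hT
  have hT0 : 0 < T := by positivity
  rcases Nat.eq_zero_or_pos n with rfl | hn
  · simp [weylSum]; positivity
  have hβ1 : β ≤ 1 := by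
    have h1 : (1 : ℝ) ≤ k * (n : ℝ) ^ (k - 1) := by
      have : 1 ≤ k * n ^ (k - 1) := Nat.mul_pos (by omega) (by positivity)
      exact_mod_cast this
    nlinarith
  have hT1 : 1 ≤ T := Real.one_le_rpow_of_pos_of_le_one_of_nonpos hpos hβ1 (by
    rw [neg_nonpos]; positivity)
  have hTk : β * T ^ k = 1 := by
    rw [hT, ← Real.rpow_natCast, ← Real.rpow_mul hpos.le,
      show (-(1 / k) : ℝ) * k = -1 by field_simp, Real.rpow_neg_one, mul_inv_cancel₀ hpos.ne']
  set y := ⌈T⌉₊ with hy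
  have hyT : T ≤ y := Nat.le_ceil T
  have hyT2 : (y : ℝ) ≤ 2 * T := by have := Nat.ceil_lt_add_one hT0.le; linarith
  rcases le_total n y with hny | hny
  · calc ‖weylSum k n β‖ ≤ n := norm_weylSum_le _ _ _
      _ ≤ y := by exact_mod_cast hny
      _ ≤ _ := by linarith
  obtain ⟨m, rfl⟩ := Nat.exists_eq_add_of_le hny
  rw [weylSum, Finset.sum_range_add]
  refine (norm_add_le _ _).trans ?_
  have h1 := norm_weylSum_le k y β
  rw [weylSum] at h1
  have hd (x : ℕ) : β * ((y + (x + 1) : ℕ) : ℝ) ^ k - β * ((y + x : ℕ) : ℝ) ^ k =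
      β * ((((y + x : ℕ) : ℝ) + 1) ^ k - ((y + x : ℕ) : ℝ) ^ k) := by
    push_cast; ring
  have hy0 : β * (y : ℝ) ^ (k - 1) ≤
      β * ((y + 1 : ℕ) : ℝ) ^ k - β * ((y + 0 : ℕ) : ℝ) ^ k := by
    have := hd 0
    rw [zero_add] at this
    rw [this]
    gcongr
    exact le_add_one_pow_sub_pow k (by omega) (by positivity)
  have hTy : 1 / T ≤ β * (y : ℝ) ^ (k - 1) := by
    calc 1 / T = β * T ^ (k - 1) := by
          rw [div_eq_iff hT0.ne', mul_assoc, ← pow_succ, Nat.sub_add_cancel (by omega), hTk]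
      _ ≤ _ := by gcongr
  have hΔ := hTy.trans hy0
  have h2 := norm_sum_eF_le_of_monotone_sub (fun x ↦ β * ((y + x : ℕ) : ℝ) ^ k) m
    (fun x ↦ by
      rw [hd, show x + 2 = x + 1 + 1 from rfl, hd (x + 1)]
      refine mul_le_mul_of_nonneg_left (add_one_pow_sub_pow_mono k (by positivity) ?_) hpos.le
      push_cast; linarith)
    (lt_of_lt_of_le (by positivity) hΔ)
    (fun x hx ↦ by
      rw [hd]
      refine le_trans ?_ h
      refine mul_le_mul_of_nonneg_left ((add_one_pow_sub_pow_le k (by positivity)).trans ?_) hpos.le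
      gcongr
      exact_mod_cast (by omega : y + x + 1 ≤ y + m))
  have h3 : 1 / (β * ((y + 1 : ℕ) : ℝ) ^ k - β * ((y + 0 : ℕ) : ℝ) ^ k) ≤ T := by
    have := one_div_le_one_div_of_le (by positivity) hΔ
    rwa [one_div_one_div] at this
  have := h2.trans h3
  linarith

lemma norm_sum_periodic_mul_sub_le (q : ℕ) (hq : 0 < q) (w v : ℕ → ℂ)
    (hw : Function.Periodic w q) (hw1 : ∀ x, ‖w x‖ ≤ 1) (hv1 : ∀ x, ‖v x‖ ≤ 1)
    (n : ℕ) {D : ℝ} (hv : ∀ x < n, ‖v (x + 1) - v x‖ ≤ D) :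
    ‖∑ x ∈ Finset.range n, w x * v x -
        (∑ x ∈ Finset.range q, w x) / q * ∑ x ∈ Finset.range n, v x‖ ≤ 2 * q * (1 + n * D) := by
  have hq0 : (q : ℂ) ≠ 0 := by exact_mod_cast hq.ne'
  have hqr : (0 : ℝ) < q := by exact_mod_cast hq
  set c := (∑ x ∈ Finset.range q, w x) / q with hc
  have hc1 : ‖c‖ ≤ 1 := by
    rw [hc, norm_div, Complex.norm_natCast, div_le_one hqr]
    refine (norm_sum_le_of_le _ fun x _ ↦ hw1 x).trans ?_
    simp
  set Z : ℕ → ℂ := fun m ↦ ∑ x ∈ Finset.range m, (w x - c) with hZ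
  have hZq : Z q = 0 := by
    simp only [hZ, Finset.sum_sub_distrib, Finset.sum_const, Finset.card_range, nsmul_eq_mul]
    rw [hc]; field_simp; ring
  have hper : Function.Periodic Z q := by
    intro m
    induction m with
    | zero => simpa [hZ] using hZq
    | succ m ih =>
      have h1 : Z (m + 1) = Z m + (w m - c) := Finset.sum_range_succ _ _
      have h2 : Z (m + q + 1) = Z (m + q) + (w (m + q) - c) := Finset.sum_range_succ _ _
      rw [show m + 1 + q = m + q + 1 by ring, h1, h2, ih, hw m]
  have hZle (m : ℕ) : ‖Z m‖ ≤ 2 * q := by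
    rw [← hper.map_mod_nat m]
    have hlt := (Nat.mod_lt m hq).le
    refine (norm_sum_le_of_le _ fun x _ ↦ (norm_sub_le _ _).trans
      (add_le_add (hw1 x) hc1)).trans ?_
    rw [Finset.sum_const, Finset.card_range, nsmul_eq_mul]
    have : ((m % q : ℕ) : ℝ) ≤ q := by exact_mod_cast hlt
    linarith
  have habel (m : ℕ) : ∑ x ∈ Finset.range m, w x * v x - c * ∑ x ∈ Finset.range m, v x =
      Z m * v m - ∑ x ∈ Finset.range m, Z (x + 1) * (v (x + 1) - v x) := by
    induction m with
    | zero => simp [hZ]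
    | succ m ih =>
      have h1 : Z (m + 1) = Z m + (w m - c) := Finset.sum_range_succ _ _
      simp only [Finset.sum_range_succ] at ih ⊢
      rw [h1]
      linear_combination ih
  rw [habel]
  refine (norm_sub_le _ _).trans ?_
  have e1 : ‖Z n * v n‖ ≤ 2 * q := by
    rw [norm_mul]
    have := hZle n
    have := hv1 n
    have := norm_nonneg (Z n)
    nlinarith
  have e2 : ‖∑ x ∈ Finset.range n, Z (x + 1) * (v (x + 1) - v x)‖ ≤ n * (2 * q * D) := by
    refine (norm_sum_le_of_le _ (n := fun _ ↦ 2 * q * D) fun x hx ↦ ?_).trans (by simp)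
    rw [norm_mul]
    have := hZle (x + 1)
    have := hv x (Finset.mem_range.1 hx)
    gcongr
  linarith

/-- The complete exponential sum of `a x ^ k / q`. -/
noncomputable def completeSum (k q : ℕ) (a : ℤ) : ℂ :=
  ∑ x ∈ Finset.range q, eF (a * (x : ℝ) ^ k / q)

/-- Major arc approximation of Weyl sums. -/
lemma norm_weylSum_sub_le (k n q : ℕ) (a : ℤ) (hq : 0 < q) (β : ℝ) :
    ‖weylSum k n (a / q + β) - completeSum k q a / q * weylSum k n β‖ ≤
      2 * q * (1 + n * (2 * Real.pi * (|β| * (k * (n : ℝ) ^ (k - 1))))) := by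
  have hq0 : (q : ℝ) ≠ 0 := by exact_mod_cast hq.ne'
  have h := norm_sum_periodic_mul_sub_le q hq (fun x ↦ eF (a * (x : ℝ) ^ k / q))
    (fun x ↦ eF (β * (x : ℝ) ^ k)) (fun x ↦ ?_) (fun x ↦ (norm_eF _).le)
    (fun x ↦ (norm_eF _).le) n (D := 2 * Real.pi * (|β| * (k * (n : ℝ) ^ (k - 1))))
    (fun x hx ↦ ?_)
  · have e : weylSum k n (a / q + β) =
        ∑ x ∈ Finset.range n, eF (a * (x : ℝ) ^ k / q) * eF (β * (x : ℝ) ^ k) := by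
      refine Finset.sum_congr rfl fun x _ ↦ ?_
      rw [← eF_add]; congr 1; field_simp
    rw [e]
    exact h
  · obtain ⟨z, hz⟩ : (q : ℤ) ∣ ((x : ℤ) + q) ^ k - (x : ℤ) ^ k :=
      dvd_trans (by simp) (sub_dvd_pow_sub_pow ((x : ℤ) + q) x k)
    have hz' : ((x : ℝ) + q) ^ k = (x : ℝ) ^ k + q * z := by
      have : (((x : ℤ) + q) ^ k : ℤ) = (x : ℤ) ^ k + q * z := by linarith
      exact_mod_cast this
    have : (a : ℝ) * ((x + q : ℕ) : ℝ) ^ k / q = a * (x : ℝ) ^ k / q + ((a * z : ℤ) : ℝ) := by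
      push_cast; rw [hz']; field_simp
    simp only [this, eF_add, eF_intCast, mul_one]
  · refine (norm_eF_sub_eF_le _ _).trans ?_
    rw [← mul_sub, abs_mul]
    gcongr
    push_cast
    rw [abs_of_nonneg (sub_nonneg.2 (by gcongr; linarith))]
    refine (add_one_pow_sub_pow_le k (by positivity)).trans ?_
    gcongr
    exact_mod_cast hx

/-- The number of `k`-th roots of unity modulo `n`. -/
def rootCount (k n : ℕ) : ℕ := ((Finset.range n).filter fun u ↦ u ^ k ≡ 1 [MOD n]).card

/-- The number of pairs of residues modulo `n` with equal `k`-th powers. -/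
def powPairCount (k n : ℕ) : ℕ :=
  ((Finset.range n ×ˢ Finset.range n).filter fun z ↦ z.1 ^ k ≡ z.2 ^ k [MOD n]).card

lemma eq_of_modEq_of_modEq {m n x y : ℕ} (h : m.Coprime n) (hx : x < m * n) (hy : y < m * n)
    (h1 : x % m = y % m) (h2 : x % n = y % n) : x = y :=
  Nat.ModEq.eq_of_lt_of_lt ((Nat.modEq_and_modEq_iff_modEq_mul h).1 ⟨h1, h2⟩) hx hy

lemma rootCount_mul_le (k : ℕ) {m n : ℕ} (hm : m ≠ 0) (hn : n ≠ 0) (h : m.Coprime n) :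
    rootCount k (m * n) ≤ rootCount k m * rootCount k n := by
  rw [rootCount, rootCount, rootCount, ← Finset.card_product]
  refine Finset.card_le_card_of_injOn (fun u ↦ (u % m, u % n)) (fun u hu ↦ ?_)
    (fun u hu v hv huv ↦ ?_)
  · simp only [Finset.coe_filter, Finset.mem_range, Set.mem_ofPred_eq, Finset.coe_product,
      Set.mem_prod] at hu ⊢
    exact ⟨⟨Nat.mod_lt _ (by omega), ((Nat.mod_modEq u m).pow k).trans (hu.2.of_mul_right n)⟩,
      ⟨Nat.mod_lt _ (by omega), ((Nat.mod_modEq u n).pow k).trans (hu.2.of_mul_left m)⟩⟩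
  · simp only [Finset.coe_filter, Finset.mem_range, Set.mem_ofPred_eq, Prod.mk.injEq] at hu hv huv
    exact eq_of_modEq_of_modEq h hu.1 hv.1 huv.1 huv.2

lemma powPairCount_mul_le (k : ℕ) {m n : ℕ} (hm : m ≠ 0) (hn : n ≠ 0) (h : m.Coprime n) :
    powPairCount k (m * n) ≤ powPairCount k m * powPairCount k n := by
  rw [powPairCount, powPairCount, powPairCount, ← Finset.card_product]
  refine Finset.card_le_card_of_injOn
    (fun z ↦ ((z.1 % m, z.2 % m), (z.1 % n, z.2 % n))) (fun z hz ↦ ?_) (fun z hz w hw hzw ↦ ?_)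
  · simp only [Finset.coe_filter, Finset.mem_range, Set.mem_ofPred_eq, Finset.coe_product,
      Set.mem_prod, Finset.mem_product] at hz ⊢
    have key (d : ℕ) (hd : d ∣ m * n) : (z.1 % d) ^ k ≡ (z.2 % d) ^ k [MOD d] :=
      ((Nat.mod_modEq _ d).pow k).trans ((hz.2.of_dvd hd).trans ((Nat.mod_modEq _ d).pow k).symm)
    exact ⟨⟨⟨Nat.mod_lt _ (by omega), Nat.mod_lt _ (by omega)⟩, key m (dvd_mul_right m n)⟩,
      ⟨⟨Nat.mod_lt _ (by omega), Nat.mod_lt _ (by omega)⟩, key n (dvd_mul_left n m)⟩⟩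
  · simp only [Finset.coe_filter, Finset.mem_range, Set.mem_ofPred_eq, Prod.mk.injEq,
      Finset.mem_product] at hz hw hzw
    exact Prod.ext (eq_of_modEq_of_modEq h hz.1.1 hw.1.1 hzw.1.1 hzw.2.1)
      (eq_of_modEq_of_modEq h hz.1.2 hw.1.2 hzw.1.2 hzw.2.2)

lemma sum_range_natCast_zmod {M : Type*} [AddCommMonoid M] (q : ℕ) [NeZero q] (g : ZMod q → M) :
    ∑ x ∈ Finset.range q, g x = ∑ x : ZMod q, g x :=
  Finset.sum_bij' (fun x _ ↦ (x : ZMod q)) (fun x _ ↦ x.val) (fun _ _ ↦ Finset.mem_univ _)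
    (fun x _ ↦ Finset.mem_range.2 (ZMod.val_lt x))
    (fun _ hx ↦ ZMod.val_cast_of_lt (Finset.mem_range.1 hx)) (fun x _ ↦ ZMod.natCast_zmod_val x)
    (fun _ _ ↦ rfl)

lemma rootCount_eq (k q : ℕ) [NeZero q] :
    rootCount k q = (Finset.univ.filter fun u : ZMod q ↦ u ^ k = 1).card := by
  rw [rootCount, Finset.card_filter, Finset.card_filter, ← sum_range_natCast_zmod]
  refine Finset.sum_congr rfl fun x _ ↦ if_congr ?_ rfl rfl
  rw [← ZMod.natCast_eq_natCast_iff]; push_cast; rfl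

lemma powPairCount_eq (k q : ℕ) [NeZero q] :
    powPairCount k q = ∑ x : ZMod q, ∑ y : ZMod q, if x ^ k - y ^ k = 0 then 1 else 0 := by
  rw [powPairCount, Finset.card_filter, Finset.sum_product, ← sum_range_natCast_zmod]
  refine Finset.sum_congr rfl fun x _ ↦ ?_
  rw [← sum_range_natCast_zmod]
  refine Finset.sum_congr rfl fun y _ ↦ if_congr ?_ rfl rfl
  rw [← ZMod.natCast_eq_natCast_iff, sub_eq_zero]; push_cast; rfl

/-- Complete exponential sums over `ZMod q`. -/
noncomputable def zmodSum (k q : ℕ) [NeZero q] (b : ZMod q) : ℂ :=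
  ∑ x : ZMod q, ZMod.stdAddChar (b * x ^ k)

lemma completeSum_eq_zmodSum (k q : ℕ) [NeZero q] (a : ℤ) :
    completeSum k q a = zmodSum k q a := by
  rw [completeSum, zmodSum, ← sum_range_natCast_zmod]
  refine Finset.sum_congr rfl fun x _ ↦ ?_
  have : (a : ZMod q) * (x : ZMod q) ^ k = ((a * x ^ k : ℤ) : ZMod q) := by push_cast; rfl
  rw [this, ZMod.stdAddChar_coe, eF]
  congr 1; push_cast; ring

lemma sum_norm_sq_zmodSum (k q : ℕ) [NeZero q] :
    ∑ b : ZMod q, ‖zmodSum k q b‖ ^ 2 = q * powPairCount k q := by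
  have h : ((∑ b : ZMod q, ‖zmodSum k q b‖ ^ 2 : ℝ) : ℂ) = ((q * powPairCount k q : ℝ) : ℂ) := by
    have e (b : ZMod q) : ((‖zmodSum k q b‖ ^ 2 : ℝ) : ℂ) =
        ∑ x : ZMod q, ∑ y : ZMod q, ZMod.stdAddChar (b * (x ^ k - y ^ k)) := by
      rw [← Complex.normSq_eq_norm_sq, ← Complex.mul_conj, zmodSum, map_sum, Finset.sum_mul_sum]
      refine Finset.sum_congr rfl fun x _ ↦ Finset.sum_congr rfl fun y _ ↦ ?_
      rw [← AddChar.map_neg_eq_conj, ← AddChar.map_add_eq_mul]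
      congr 1; ring
    rw [Complex.ofReal_sum]
    simp only [e]
    rw [Finset.sum_comm]
    have e2 (x : ZMod q) : ∑ b : ZMod q, ∑ y : ZMod q,
        (ZMod.stdAddChar (b * (x ^ k - y ^ k)) : ℂ) =
        ∑ y : ZMod q, q * (if x ^ k - y ^ k = 0 then 1 else 0 : ℂ) := by
      rw [Finset.sum_comm]
      refine Finset.sum_congr rfl fun y _ ↦ ?_
      rw [AddChar.sum_mulShift _ (ZMod.isPrimitive_stdAddChar q), ZMod.card]
      split_ifs <;> simp
    simp only [e2, ← Finset.mul_sum]
    rw [powPairCount_eq]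
    push_cast
    congr 1
    refine Finset.sum_congr rfl fun x _ ↦ Finset.sum_congr rfl fun y _ ↦ ?_
    split_ifs <;> simp
  exact_mod_cast h

lemma zmodSum_mul_unit_pow (k q : ℕ) [NeZero q] (b : ZMod q) (c : (ZMod q)ˣ) :
    zmodSum k q (b * (c : ZMod q) ^ k) = zmodSum k q b := by
  refine Fintype.sum_equiv (Units.mulLeft c) _ _ fun x ↦ ?_
  rw [Units.mulLeft_apply, mul_pow, mul_assoc]

lemma card_filter_mul_pow_eq_le (k q : ℕ) [NeZero q] (a b : ZMod q) (ha : IsUnit a) :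
    ((Finset.univ : Finset (ZMod q)ˣ).filter fun c : (ZMod q)ˣ ↦ a * (c : ZMod q) ^ k = b).card ≤
      rootCount k q := by
  rw [rootCount_eq]
  rcases Finset.eq_empty_or_nonempty
    ((Finset.univ : Finset (ZMod q)ˣ).filter fun c : (ZMod q)ˣ ↦ a * (c : ZMod q) ^ k = b) with h | ⟨c₀, hc₀⟩
  · simp [h]
  · refine Finset.card_le_card_of_injOn (fun c ↦ ((c * c₀⁻¹ : (ZMod q)ˣ) : ZMod q))
      (fun c hc ↦ ?_) (fun c _ d _ hcd ↦ ?_)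
    · simp only [Finset.coe_filter, Finset.mem_univ, true_and, Set.mem_ofPred_eq,
        Finset.mem_filter] at hc hc₀ ⊢
      have h1 : (c : ZMod q) ^ k = (c₀ : ZMod q) ^ k := ha.mul_left_cancel (hc.trans hc₀.symm)
      have h2 : c ^ k = c₀ ^ k := Units.ext (by push_cast; exact h1)
      rw [← Units.val_pow_eq_pow_val, mul_pow, h2, ← mul_pow, mul_inv_cancel, one_pow,
        Units.val_one]
    · exact mul_right_cancel (Units.ext hcd)

lemma totient_mul_norm_sq_zmodSum_le (k q : ℕ) [NeZero q] (a : ZMod q) (ha : IsUnit a) :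
    q.totient * ‖zmodSum k q a‖ ^ 2 ≤ rootCount k q * (q * powPairCount k q) := by
  calc (q.totient : ℝ) * ‖zmodSum k q a‖ ^ 2
      = ∑ c : (ZMod q)ˣ, ‖zmodSum k q (a * (c : ZMod q) ^ k)‖ ^ 2 := by
        simp only [zmodSum_mul_unit_pow]
        rw [Finset.sum_const, Finset.card_univ, ZMod.card_units_eq_totient, nsmul_eq_mul]
    _ = ∑ b : ZMod q, ∑ c ∈ Finset.univ.filter fun c : (ZMod q)ˣ ↦ a * (c : ZMod q) ^ k = b,
          ‖zmodSum k q (a * (c : ZMod q) ^ k)‖ ^ 2 := (Finset.sum_fiberwise _ _ _).symm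
    _ ≤ ∑ b : ZMod q, rootCount k q * ‖zmodSum k q b‖ ^ 2 := by
        refine Finset.sum_le_sum fun b _ ↦ ?_
        rw [Finset.sum_congr rfl (g := fun _ ↦ ‖zmodSum k q b‖ ^ 2)
          (fun c hc ↦ by rw [(Finset.mem_filter.1 hc).2]), Finset.sum_const, nsmul_eq_mul]
        gcongr
        exact card_filter_mul_pow_eq_le k q a b ha
    _ = _ := by rw [← Finset.mul_sum, sum_norm_sq_zmodSum]

lemma rootCount_eq_card_units (k q : ℕ) [NeZero q] (hk : k ≠ 0) :
    rootCount k q = ((Finset.univ : Finset (ZMod q)ˣ).filter fun u ↦ u ^ k = 1).card := by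
  rw [rootCount_eq]
  symm
  refine Finset.card_bij (fun u _ ↦ (u : ZMod q)) (fun u hu ↦ ?_) (fun u _ v _ h ↦ Units.ext h)
    (fun u hu ↦ ?_)
  · rw [Finset.mem_filter] at hu ⊢
    exact ⟨Finset.mem_univ _, by rw [← Units.val_pow_eq_pow_val, hu.2, Units.val_one]⟩
  · rw [Finset.mem_filter] at hu
    exact ⟨Units.ofPowEqOne u k hu.2 hk,
      Finset.mem_filter.2 ⟨Finset.mem_univ _, Units.pow_ofPowEqOne hu.2 hk⟩, rfl⟩

/-- A finite commutative group with a cyclic subgroup of index at most `2` has at most `2 k`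
solutions of `u ^ k = 1`. -/
lemma card_pow_eq_one_le_two_mul {G : Type*} [CommGroup G] [Fintype G] [DecidableEq G]
    (H : Subgroup G) [IsCyclic H] (hH : H.index ≤ 2) (hH0 : H.index ≠ 0) {k : ℕ} (hk : k ≠ 0) :
    ((Finset.univ : Finset G).filter fun u ↦ u ^ k = 1).card ≤ 2 * k := by
  classical
  set K : Subgroup G := (powMonoidHom k : G →* G).ker with hK
  have h1 : ((Finset.univ : Finset G).filter fun u ↦ u ^ k = 1).card = Nat.card K := by
    rw [Nat.card_eq_fintype_card, Fintype.card_subtype]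
    congr 1
    ext u
    simp [hK, MonoidHom.mem_ker]
  rw [h1, ← (H.subgroupOf K).card_mul_index]
  have h2 : (H.subgroupOf K).index ≤ 2 := by
    have : (H.subgroupOf K).index ∣ H.index := Subgroup.relIndex_dvd_index_of_normal H K
    exact (Nat.le_of_dvd (Nat.pos_of_ne_zero hH0) this).trans hH
  have h3 : Nat.card (H.subgroupOf K) ≤ k := by
    have := IsCyclic.card_pow_eq_one_le (α := H) (Nat.pos_of_ne_zero hk)
    refine le_trans ?_ this
    rw [← Fintype.card_subtype, ← Nat.card_eq_fintype_card]
    refine Nat.card_le_card_of_injective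
      (fun u : H.subgroupOf K ↦ (⟨⟨u.1.1, u.2⟩, Subtype.ext u.1.2⟩ : {a : H // a ^ k = 1}))
      fun u v huv ↦ ?_
    exact Subtype.ext (Subtype.ext (congrArg (fun z ↦ ((z.1 : H) : G)) huv))
  nlinarith

lemma rootCount_prime_pow_le (k : ℕ) (hk : k ≠ 0) {p l : ℕ} (hp : p.Prime) :
    rootCount k (p ^ l) ≤ 2 * k := by
  have : NeZero (p ^ l) := ⟨(pow_pos hp.pos l).ne'⟩
  rw [rootCount_eq_card_units k _ hk]
  by_cases hc : IsCyclic (ZMod (p ^ l))ˣ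
  · exact (IsCyclic.card_pow_eq_one_le (Nat.pos_of_ne_zero hk)).trans (by omega)
  have hp2 : p = 2 := by
    by_contra h
    exact hc (ZMod.isCyclic_units_of_prime_pow p hp h l)
  subst hp2
  rw [ZMod.isCyclic_units_two_pow_iff, not_le] at hc
  obtain ⟨n, rfl⟩ : ∃ n, l = n + 2 := ⟨l - 2, by omega⟩
  have h5 : IsUnit (5 : ZMod (2 ^ (n + 2))) := by
    refine (ZMod.isUnit_iff_coprime 5 _).2 ?_
    exact Nat.Coprime.pow_right _ (by norm_num)
  have ho : orderOf h5.unit = 2 ^ n := by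
    rw [← orderOf_units, IsUnit.unit_spec, ZMod.orderOf_five]
  have hidx : (Subgroup.zpowers h5.unit).index = 2 := by
    have h := (Subgroup.zpowers h5.unit).card_mul_index
    rw [Nat.card_zpowers, ho, Nat.card_eq_fintype_card, ZMod.card_units_eq_totient,
      Nat.totient_prime_pow Nat.prime_two (by omega)] at h
    have h2 : 2 ^ n * (Subgroup.zpowers h5.unit).index = 2 ^ n * 2 := by
      rw [h, show n + 2 - 1 = n + 1 by omega, pow_succ, show 2 - 1 = 1 from rfl, mul_one]
    exact Nat.eq_of_mul_eq_mul_left (by positivity) h2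
  exact card_pow_eq_one_le_two_mul (Subgroup.zpowers h5.unit) hidx.le (by omega) hk

/-- Recursive bound for `powPairCount` at prime powers. -/
lemma powPairCount_prime_pow_le_add (k : ℕ) (hk : k ≠ 0) {p l : ℕ} (hp : p.Prime) (hl : l ≠ 0) :
    powPairCount k (p ^ l) ≤ 2 * k * p ^ l +
      ((Finset.range (p ^ (l - 1)) ×ˢ Finset.range (p ^ (l - 1))).filter fun z ↦
        (p * z.1) ^ k ≡ (p * z.2) ^ k [MOD p ^ l]).card := by
  have : NeZero (p ^ l) := ⟨(pow_pos hp.pos l).ne'⟩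
  have hpl : p ^ l = p * p ^ (l - 1) := by rw [← pow_succ', Nat.sub_add_cancel (by omega)]
  rw [powPairCount, ← Finset.card_filter_add_card_filter_not (fun z : ℕ × ℕ ↦ ¬ p ∣ z.2)]
  refine add_le_add ?_ ?_
  · rw [Finset.filter_filter, Finset.card_filter, Finset.sum_product_right]
    calc _ ≤ ∑ y ∈ Finset.range (p ^ l), 2 * k := by
          refine Finset.sum_le_sum fun y _ ↦ ?_
          by_cases hy : p ∣ y
          · simp [hy]
          have hyu : IsUnit (y : ZMod (p ^ l)) := by
            rw [ZMod.isUnit_iff_coprime]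
            exact Nat.Coprime.pow_right _ ((Nat.Prime.coprime_iff_not_dvd hp).2 hy).symm
          refine le_trans ?_ (rootCount_prime_pow_le k hk hp (l := l))
          rw [rootCount_eq, ← Finset.card_filter]
          refine Finset.card_le_card_of_injOn (fun x : ℕ ↦ (x : ZMod (p ^ l)) * ↑hyu.unit⁻¹)
            (fun x hx ↦ ?_) (fun x hx x' hx' h ↦ ?_)
          · simp only [Finset.coe_filter, Finset.mem_range, Set.mem_ofPred_eq] at hx
            have := (ZMod.natCast_eq_natCast_iff _ _ _).2 hx.2.1
            push_cast at this
            simp only [Finset.coe_filter, Finset.mem_univ, true_and, Set.mem_ofPred_eq]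
            rw [mul_pow, this, ← mul_pow, IsUnit.mul_val_inv, one_pow]
          · simp only [Finset.coe_filter, Finset.mem_range, Set.mem_ofPred_eq] at hx hx'
            have := (Units.mul_left_inj _).1 h
            exact Nat.ModEq.eq_of_lt_of_lt ((ZMod.natCast_eq_natCast_iff _ _ _).1 this) hx.1 hx'.1
      _ = _ := by simp [mul_comm]
  · rw [Finset.filter_filter]
    have hdvd {x y : ℕ} (h : x ^ k ≡ y ^ k [MOD p ^ l]) (hy : p ∣ y) : p ∣ x := by
      have h1 : x ^ k ≡ y ^ k [MOD p] := h.of_dvd (dvd_pow_self p hl)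
      exact hp.dvd_of_dvd_pow ((h1.dvd_iff dvd_rfl).2 (dvd_pow hy hk))
    refine Finset.card_le_card_of_injOn (fun z ↦ (z.1 / p, z.2 / p)) (fun z hz ↦ ?_)
      (fun z hz w hw h ↦ ?_)
    · simp only [Finset.coe_filter, Finset.mem_range, Set.mem_ofPred_eq, Finset.mem_product,
        not_not] at hz ⊢
      rw [Nat.mul_div_cancel' hz.2.2, Nat.mul_div_cancel' (hdvd hz.2.1 hz.2.2)]
      rw [hpl] at hz
      exact ⟨⟨Nat.div_lt_of_lt_mul hz.1.1, Nat.div_lt_of_lt_mul hz.1.2⟩, by rw [hpl]; exact hz.2.1⟩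
    · simp only [Finset.coe_filter, Finset.mem_range, Set.mem_ofPred_eq, Finset.mem_product,
        not_not, Prod.mk.injEq] at hz hw h
      refine Prod.ext ?_ ?_
      · rw [← Nat.mul_div_cancel' (hdvd hz.2.1 hz.2.2), h.1,
          Nat.mul_div_cancel' (hdvd hw.2.1 hw.2.2)]
      · rw [← Nat.mul_div_cancel' hz.2.2, h.2, Nat.mul_div_cancel' hw.2.2]

lemma card_filter_mul_pow_modEq_le (k : ℕ) {p l : ℕ} (hp : p.Prime) (hk : k ≠ 0) (hl : k < l) :
    ((Finset.range (p ^ (l - 1)) ×ˢ Finset.range (p ^ (l - 1))).filter fun z ↦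
        (p * z.1) ^ k ≡ (p * z.2) ^ k [MOD p ^ l]).card ≤
      p ^ (2 * (k - 1)) * powPairCount k (p ^ (l - k)) := by
  have hd : 0 < p ^ (l - k) := pow_pos hp.pos _
  have hpl : p ^ (l - 1) = p ^ (l - k) * p ^ (k - 1) := by rw [← pow_add]; congr 1; omega
  have hcard : p ^ (2 * (k - 1)) * powPairCount k (p ^ (l - k)) =
      ((Finset.range (p ^ (k - 1)) ×ˢ Finset.range (p ^ (k - 1))) ×ˢ
        ((Finset.range (p ^ (l - k)) ×ˢ Finset.range (p ^ (l - k))).filter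
          fun z ↦ z.1 ^ k ≡ z.2 ^ k [MOD p ^ (l - k)])).card := by
    rw [Finset.card_product, Finset.card_product, Finset.card_range, ← pow_add, two_mul,
      powPairCount]
  rw [hcard]
  refine Finset.card_le_card_of_injOn (fun z ↦ ((z.1 / p ^ (l - k), z.2 / p ^ (l - k)),
    (z.1 % p ^ (l - k), z.2 % p ^ (l - k)))) (fun z hz ↦ ?_) (fun z hz w hw h ↦ ?_)
  · simp only [Finset.coe_filter, Finset.mem_range, Set.mem_ofPred_eq, Finset.mem_product,
      Finset.coe_product, Set.mem_prod, Finset.mem_coe] at hz ⊢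
    rw [hpl] at hz
    refine ⟨⟨Nat.div_lt_of_lt_mul hz.1.1, Nat.div_lt_of_lt_mul hz.1.2⟩,
      ⟨Nat.mod_lt _ hd, Nat.mod_lt _ hd⟩, ?_⟩
    have h := hz.2
    rw [mul_pow, mul_pow, show p ^ l = p ^ k * p ^ (l - k) by rw [← pow_add]; congr 1; omega] at h
    have h' := Nat.ModEq.mul_left_cancel' (pow_pos hp.pos k).ne' h
    exact ((Nat.mod_modEq _ _).pow k).trans (h'.trans ((Nat.mod_modEq _ _).pow k).symm)
  · simp only [Prod.mk.injEq] at h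
    refine Prod.ext ?_ ?_
    · rw [← Nat.div_add_mod z.1 (p ^ (l - k)), h.1.1, h.2.1, Nat.div_add_mod]
    · rw [← Nat.div_add_mod z.2 (p ^ (l - k)), h.1.2, h.2.2, Nat.div_add_mod]

lemma powPairCount_prime_pow_le (k : ℕ) (hk : 2 ≤ k) {p : ℕ} (hp : p.Prime) (l : ℕ) (hl : l ≠ 0) :
    (powPairCount k (p ^ l) : ℝ) ≤ (2 * k + 1) * (l + 1) * ((p : ℝ) ^ l) ^ (2 - 2 / k : ℝ) := by
  have hk0 : (0 : ℝ) < k := by positivity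
  have hk2 : (2 : ℝ) ≤ k := by exact_mod_cast hk
  have hp1 : (1 : ℝ) ≤ p := by exact_mod_cast hp.one_le
  have hp0 : (0 : ℝ) < p := by linarith
  have hkk : (2 : ℝ) / k ≤ 1 := by rw [div_le_one hk0]; exact hk2
  induction l using Nat.strong_induction_on with
  | _ l ih =>
  have h1 := powPairCount_prime_pow_le_add k (by omega) hp hl
  set c := ((Finset.range (p ^ (l - 1)) ×ˢ Finset.range (p ^ (l - 1))).filter fun z ↦
        (p * z.1) ^ k ≡ (p * z.2) ^ k [MOD p ^ l]).card with hc
  set B : ℝ := ((p : ℝ) ^ l) ^ (2 - 2 / k : ℝ) with hB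
  have hB' : B = (p : ℝ) ^ (l * (2 - 2 / k) : ℝ) := by
    rw [hB, ← Real.rpow_natCast, ← Real.rpow_mul hp0.le]
  have hlB : (p : ℝ) ^ l ≤ B := by
    have := Real.rpow_le_rpow_of_exponent_le (one_le_pow₀ hp1 : (1 : ℝ) ≤ (p : ℝ) ^ l)
      (show (1 : ℝ) ≤ 2 - 2 / k by linarith)
    rwa [Real.rpow_one] at this
  have hB0 : 0 < B := lt_of_lt_of_le (by positivity) hlB
  have h1' : (powPairCount k (p ^ l) : ℝ) ≤ 2 * k * (p : ℝ) ^ l + c := by exact_mod_cast h1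
  have hl1 : (1 : ℝ) ≤ l := by exact_mod_cast Nat.one_le_iff_ne_zero.2 hl
  have hmain : (c : ℝ) ≤ (2 * k + 1) * l * B := by
    rcases le_or_gt l k with hlk | hlk
    · have h2 : c ≤ p ^ (2 * (l - 1)) := by
        refine (Finset.card_filter_le _ _).trans_eq ?_
        rw [Finset.card_product, Finset.card_range, ← pow_add, two_mul]
      have h3 : (p : ℝ) ^ (2 * (l - 1)) ≤ B := by
        rw [hB', ← Real.rpow_natCast]
        refine Real.rpow_le_rpow_of_exponent_le hp1 ?_
        push_cast [Nat.cast_sub (Nat.one_le_iff_ne_zero.2 hl)]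
        have : (l : ℝ) / k ≤ 1 := by rw [div_le_one hk0]; exact_mod_cast hlk
        have e : (l : ℝ) * (2 - 2 / k) = 2 * l - 2 * (l / k) := by ring
        rw [e]; linarith
      have h4 : (c : ℝ) ≤ (p : ℝ) ^ (2 * (l - 1)) := by exact_mod_cast h2
      have h5 : 1 ≤ (2 * (k : ℝ) + 1) * l := by nlinarith
      nlinarith
    · have h2 := card_filter_mul_pow_modEq_le k hp (by omega) hlk
      rw [← hc] at h2
      have h3 : (c : ℝ) ≤ (p : ℝ) ^ (2 * (k - 1)) * powPairCount k (p ^ (l - k)) := by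
        exact_mod_cast h2
      have h4 := ih (l - k) (by omega) (by omega)
      have h5 : (p : ℝ) ^ (2 * (k - 1)) * ((p : ℝ) ^ (l - k)) ^ (2 - 2 / k : ℝ) = B := by
        rw [hB', ← Real.rpow_natCast _ (l - k), ← Real.rpow_mul hp0.le, ← Real.rpow_natCast,
          ← Real.rpow_add hp0]
        congr 1
        push_cast [Nat.cast_sub (show 1 ≤ k by omega), Nat.cast_sub hlk.le]
        field_simp
        ring
      have h6 : ((l - k : ℕ) : ℝ) + 1 ≤ l := by
        exact_mod_cast (by omega : l - k + 1 ≤ l)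
      calc (c : ℝ) ≤ _ := h3
        _ ≤ (p : ℝ) ^ (2 * (k - 1)) * ((2 * k + 1) * l * ((p : ℝ) ^ (l - k)) ^ (2 - 2 / k : ℝ)) := by
            refine mul_le_mul_of_nonneg_left (h4.trans ?_) (by positivity)
            gcongr
        _ = (2 * k + 1) * l *
              ((p : ℝ) ^ (2 * (k - 1)) * ((p : ℝ) ^ (l - k)) ^ (2 - 2 / k : ℝ)) := by ring
        _ = _ := by rw [h5]
  calc (powPairCount k (p ^ l) : ℝ) ≤ 2 * k * B + (2 * k + 1) * l * B := by
        refine h1'.trans (add_le_add ?_ hmain)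
        gcongr
    _ ≤ _ := by nlinarith

/-- Complete exponential sums have a power saving. -/
lemma exists_norm_completeSum_le (k : ℕ) (hk : 2 ≤ k) :
    ∃ A : ℝ, 1 ≤ A ∧ ∀ (q : ℕ) (a : ℤ), 0 < q → IsCoprime a (q : ℤ) →
      ‖completeSum k q a‖ ^ 2 ≤ A * (q : ℝ) ^ (2 - 1 / k : ℝ) := by
  have hk0 : (0 : ℝ) < k := by positivity
  set f : ℕ → ℝ := fun n ↦ rootCount k n * powPairCount k n / n.totient with hf
  have hf1 : f 1 ≤ 1 := by
    simp [hf, rootCount, powPairCount, Nat.modEq_one]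
  have hmul (m n : ℕ) (hm : m ≠ 0) (hn : n ≠ 0) (h : m.Coprime n) : f (m * n) ≤ f m * f n := by
    have h1 : (rootCount k (m * n) : ℝ) ≤ rootCount k m * rootCount k n := by
      exact_mod_cast rootCount_mul_le k hm hn h
    have h2 : (powPairCount k (m * n) : ℝ) ≤ powPairCount k m * powPairCount k n := by
      exact_mod_cast powPairCount_mul_le k hm hn h
    simp only [hf]
    rw [Nat.totient_mul h, div_mul_div_comm]
    push_cast
    refine div_le_div_of_nonneg_right ?_ (by positivity)
    calc _ ≤ (rootCount k m * rootCount k n : ℝ) * (powPairCount k m * powPairCount k n) := by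
          gcongr
      _ = _ := by ring
  have hK : (1 : ℝ) ≤ 4 * k * (2 * k + 1) := by
    have : (2 : ℝ) ≤ k := by exact_mod_cast hk
    nlinarith
  have hpp (p l : ℕ) (hp : p.Prime) (hl : l ≠ 0) :
      f (p ^ l) ≤ 4 * k * (2 * k + 1) * (l + 1) * ((p : ℝ) ^ l) ^ (1 - 2 / k : ℝ) := by
    have hp0 : (0 : ℝ) < p := by exact_mod_cast hp.pos
    have h1 : (rootCount k (p ^ l) : ℝ) ≤ 2 * k := by
      exact_mod_cast rootCount_prime_pow_le k (by omega) hp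
    have h2 := powPairCount_prime_pow_le k hk hp l hl
    have h3 : (p : ℝ) ^ l / 2 ≤ (p ^ l).totient := by
      have : p ^ l ≤ 2 * (p ^ l).totient := by
        rw [Nat.totient_prime_pow hp (Nat.pos_of_ne_zero hl)]
        have h2p := hp.two_le
        calc p ^ l = p ^ (l - 1) * p := by rw [← pow_succ, Nat.sub_add_cancel (by omega)]
          _ ≤ p ^ (l - 1) * (2 * (p - 1)) := by gcongr; omega
          _ = _ := by ring
      have : (p : ℝ) ^ l ≤ 2 * (p ^ l).totient := by exact_mod_cast this
      linarith
    have hpl : (0 : ℝ) < (p : ℝ) ^ l := by positivity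
    simp only [hf]
    calc _ ≤ 2 * k * ((2 * k + 1) * (l + 1) * ((p : ℝ) ^ l) ^ (2 - 2 / k : ℝ)) /
          ((p : ℝ) ^ l / 2) := by gcongr
      _ = 4 * k * (2 * k + 1) * (l + 1) * (((p : ℝ) ^ l) ^ (2 - 2 / k : ℝ) / ((p : ℝ) ^ l) ^ (1 : ℝ)) := by
          rw [Real.rpow_one]; field_simp; ring
      _ = _ := by rw [← Real.rpow_sub hpl]; congr 2; ring
  obtain ⟨A, hA, H⟩ := exists_le_rpow_of_submultiplicative f hf1 (fun n ↦ by positivity) hmul hK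
    hpp (ε := 1 / k) (by positivity)
  refine ⟨A, hA, fun q a hq ha ↦ ?_⟩
  have : NeZero q := ⟨hq.ne'⟩
  have hu : IsUnit (a : ZMod q) := by
    obtain ⟨u, v, huv⟩ := ha
    refine IsUnit.of_mul_eq_one (u : ZMod q) ?_
    have := congrArg (fun z : ℤ ↦ (z : ZMod q)) huv
    push_cast at this
    rw [ZMod.natCast_self, mul_zero, add_zero, mul_comm] at this
    exact this
  have h1 := totient_mul_norm_sq_zmodSum_le k q a hu
  rw [← completeSum_eq_zmodSum] at h1
  have ht : (0 : ℝ) < q.totient := by exact_mod_cast Nat.totient_pos.2 hq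
  have hq0 : (0 : ℝ) < q := by exact_mod_cast hq
  have h2 := H q hq.ne'
  calc ‖completeSum k q a‖ ^ 2 ≤ q * f q := by
        simp only [hf]
        rw [← mul_le_mul_iff_right₀ ht]
        refine h1.trans_eq ?_
        field_simp
    _ ≤ q * (A * (q : ℝ) ^ (1 - 2 / k + 1 / k : ℝ)) := by gcongr
    _ = A * ((q : ℝ) ^ (1 : ℝ) * (q : ℝ) ^ (1 - 2 / k + 1 / k : ℝ)) := by
        rw [Real.rpow_one]; ring
    _ = _ := by rw [← Real.rpow_add hq0]; congr 2; ring

/-- If a Weyl sum is large then its argument lies in a narrow major arc. -/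
lemma exists_major_arc_of_weylSum_large (k : ℕ) (hk : 2 ≤ k) {τ : ℝ}
    (hτ : 2 ^ (k - 1) * τ ≤ 1 / 40) :
    ∃ (n₀ : ℕ) (A : ℝ), 1 ≤ A ∧ ∀ (n : ℕ) (γ : ℝ), n₀ ≤ n →
      (n : ℝ) ^ (1 - τ) ≤ ‖weylSum k n γ‖ →
      ∃ (q : ℕ) (a : ℤ), 0 < q ∧ (q : ℝ) ≤ A * (n : ℝ) ^ (2 * k * τ) ∧
        |γ - a / q| ≤ A * (n : ℝ) ^ (2 * k * τ - k) / q := by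
  have hk0 : (0 : ℝ) < k := by positivity
  have hkR : (2 : ℝ) ≤ k := by exact_mod_cast hk
  obtain ⟨n₁, H1⟩ := exists_approx_of_weylSum_large k hk hτ
  obtain ⟨A, hA, HA⟩ := exists_norm_completeSum_le k hk
  obtain ⟨n₂, hn₂2, H2⟩ := exists_nat_forall_le_rpow (4 + 32 * k) (ε := 1 / 2) (by norm_num)
  refine ⟨max n₁ n₂, (12 * A) ^ k, one_le_pow₀ (by linarith), fun n γ hn hlarge ↦ ?_⟩
  have hn2 : n₂ ≤ n := (le_max_right _ _).trans hn
  have hn0 : 2 ≤ n := hn₂2.trans hn2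
  obtain ⟨q, a, hq, hcop, hq8, hβ8⟩ := H1 n γ ((le_max_left _ _).trans hn) hlarge
  have hsize := H2 n hn2
  have hS := HA q a hq hcop
  have hτ1 : τ ≤ 1 / 80 := by
    have : (2 : ℝ) ^ 1 ≤ 2 ^ (k - 1) := pow_le_pow_right₀ (by norm_num) (by omega)
    by_contra! h
    nlinarith
  set x : ℝ := (n : ℝ) with hx
  have hx1 : 1 ≤ x := by rw [hx]; exact_mod_cast (by omega : 1 ≤ n)
  have hx0 : 0 < x := by linarith
  have hq0 : (0 : ℝ) < q := by exact_mod_cast hq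
  have hq1 : (1 : ℝ) ≤ q := by exact_mod_cast hq
  set β : ℝ := γ - a / q with hβ
  have hmaj := norm_weylSum_sub_le k n q a hq β
  rw [show (a : ℝ) / q + β = γ by rw [hβ]; ring, ← hx] at hmaj
  have hxk : x * x ^ (k - 1) = x ^ (k : ℝ) := by
    rw [Real.rpow_natCast, ← pow_succ', Nat.sub_add_cancel (by omega)]
  have h8 : x ^ (1 / 8 - k : ℝ) * x ^ (k : ℝ) = x ^ (1 / 8 : ℝ) := by
    rw [← Real.rpow_add hx0]; congr 1; ring
  have hpi : Real.pi ≤ 4 := Real.pi_lt_four.le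
  have h12 : x ^ (1 / 8 : ℝ) * x ^ (1 / 2 : ℝ) ≤ x ^ (1 - τ) := by
    rw [← Real.rpow_add hx0]
    exact Real.rpow_le_rpow_of_exponent_le hx1 (by linarith)
  have herr : 2 * q * (1 + x * (2 * Real.pi * (|β| * (k * x ^ (k - 1))))) ≤ x ^ (1 - τ) / 2 := by
    have h88 : 0 < x ^ (1 / 8 : ℝ) := by positivity
    calc _ = 2 * q + 4 * k * Real.pi * ((q * |β|) * (x * x ^ (k - 1))) := by ring
      _ ≤ 2 * x ^ (1 / 8 : ℝ) + 4 * k * 4 * (x ^ (1 / 8 - k : ℝ) * (x * x ^ (k - 1))) := by gcongr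
      _ = (2 + 16 * k) * x ^ (1 / 8 : ℝ) := by rw [hxk, h8]; ring
      _ ≤ x ^ (1 / 8 : ℝ) * x ^ (1 / 2 : ℝ) / 2 := by nlinarith
      _ ≤ _ := by linarith
  have hprod : x ^ (1 - τ) / 2 ≤ ‖completeSum k q a‖ / q * ‖weylSum k n β‖ := by
    have h1 := norm_sub_norm_le (weylSum k n γ) (completeSum k q a / q * weylSum k n β)
    rw [norm_mul, norm_div, Complex.norm_natCast] at h1
    linarith
  have hsq : x ^ (2 - 2 * τ) ≤ 4 * A * (q : ℝ) ^ (-(1 / k) : ℝ) * ‖weylSum k n β‖ ^ 2 := by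
    have e1 : x ^ (2 - 2 * τ) = 4 * (x ^ (1 - τ) / 2) ^ 2 := by
      rw [div_pow, ← Real.rpow_natCast (x ^ (1 - τ)), ← Real.rpow_mul hx0.le]
      push_cast
      rw [show (1 - τ) * 2 = 2 - 2 * τ by ring]; ring
    have e2 : (q : ℝ) ^ (2 - 1 / k : ℝ) = q ^ 2 * (q : ℝ) ^ (-(1 / k) : ℝ) := by
      rw [← Real.rpow_natCast, ← Real.rpow_add hq0]; congr 1
    rw [e1]
    calc 4 * (x ^ (1 - τ) / 2) ^ 2 ≤ 4 * (‖completeSum k q a‖ / q * ‖weylSum k n β‖) ^ 2 := by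
          gcongr
      _ = 4 * (‖completeSum k q a‖ ^ 2 / q ^ 2 * ‖weylSum k n β‖ ^ 2) := by ring
      _ ≤ 4 * (A * (q : ℝ) ^ (2 - 1 / k : ℝ) / q ^ 2 * ‖weylSum k n β‖ ^ 2) := by gcongr
      _ = _ := by rw [e2]; field_simp
  have hqinv : (q : ℝ) ^ (1 / k : ℝ) * (q : ℝ) ^ (-(1 / k) : ℝ) = 1 := by
    rw [← Real.rpow_add hq0]; simp
  have hroot {y K u : ℝ} (hy : 0 ≤ y) (hK : 0 ≤ K) (h : y ^ (1 / k : ℝ) ≤ K * x ^ u) :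
      y ≤ K ^ k * x ^ (k * u) := by
    have := pow_le_pow_left₀ (by positivity) h k
    rw [mul_pow, ← Real.rpow_natCast (x ^ u), ← Real.rpow_mul hx0.le,
      ← Real.rpow_natCast (y ^ _), ← Real.rpow_mul hy, one_div_mul_cancel hk0.ne', Real.rpow_one,
      mul_comm u] at this
    exact this
  have hFn : ‖weylSum k n β‖ ≤ x := norm_weylSum_le k n β
  refine ⟨q, a, hq, ?_, ?_⟩
  · have h : (q : ℝ) ^ (1 / k : ℝ) ≤ 12 * A * x ^ (2 * τ) := by
      have h1 : x ^ (2 - 2 * τ) ≤ 4 * A * (q : ℝ) ^ (-(1 / k) : ℝ) * x ^ 2 := hsq.trans (by gcongr)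
      have e : x ^ (2 - 2 * τ) * x ^ (2 * τ) = x ^ 2 := by
        rw [← Real.rpow_natCast, ← Real.rpow_add hx0]; congr 1; push_cast; ring
      rw [← e] at h1
      have h2 : 1 ≤ 4 * A * (q : ℝ) ^ (-(1 / k) : ℝ) * x ^ (2 * τ) := by
        have hp : 0 < x ^ (2 - 2 * τ) := by positivity
        rw [← mul_le_mul_iff_right₀ hp]
        linarith
      calc (q : ℝ) ^ (1 / k : ℝ) = (q : ℝ) ^ (1 / k : ℝ) * 1 := (mul_one _).symm
        _ ≤ (q : ℝ) ^ (1 / k : ℝ) * (4 * A * (q : ℝ) ^ (-(1 / k) : ℝ) * x ^ (2 * τ)) := by gcongr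
        _ = 4 * A * x ^ (2 * τ) * ((q : ℝ) ^ (1 / k : ℝ) * (q : ℝ) ^ (-(1 / k) : ℝ)) := by ring
        _ ≤ _ := by
          rw [hqinv, mul_one]
          gcongr
          norm_num
    rw [show 2 * k * τ = k * (2 * τ) by ring]
    exact hroot hq0.le (by linarith) h
  · rw [← hβ]
    rcases eq_or_ne β 0 with h0 | h0
    · rw [h0, abs_zero]; positivity
    have hb0 : 0 < |β| := abs_pos.2 h0
    have hsmall : |β| * (k * x ^ (k - 1)) ≤ 1 / 2 := by
      have h1 : |β| ≤ x ^ (1 / 8 - k : ℝ) := by nlinarith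
      have h2 : x ^ (1 / 8 - k : ℝ) * x ^ (k - 1) * x ^ (1 / 2 : ℝ) ≤ 1 := by
        rw [← Real.rpow_natCast, ← Real.rpow_add hx0, ← Real.rpow_add hx0]
        refine Real.rpow_le_one_of_one_le_of_nonpos hx1 ?_
        push_cast [Nat.cast_sub (show 1 ≤ k by omega)]
        linarith
      calc |β| * (k * x ^ (k - 1)) ≤ x ^ (1 / 8 - k : ℝ) * (k * x ^ (k - 1)) := by gcongr
        _ = x ^ (1 / 8 - k : ℝ) * x ^ (k - 1) * k := by ring
        _ ≤ x ^ (1 / 8 - k : ℝ) * x ^ (k - 1) * (x ^ (1 / 2 : ℝ) / 2) := by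
          gcongr; linarith
        _ ≤ _ := by linarith
    have hF := norm_weylSum_le_of_small k n hk h0 hsmall
    have h : (q * |β|) ^ (1 / k : ℝ) ≤ 12 * A * x ^ (2 * τ - 1) := by
      have h1 : x ^ (2 - 2 * τ) ≤
          4 * A * (q : ℝ) ^ (-(1 / k) : ℝ) * (x * (3 * |β| ^ (-(1 / k) : ℝ))) := by
        refine hsq.trans ?_
        rw [sq]
        gcongr
      have hbinv : |β| ^ (1 / k : ℝ) * |β| ^ (-(1 / k) : ℝ) = 1 := by
        rw [← Real.rpow_add hb0]; simp
      have e : x ^ (2 - 2 * τ) * x ^ (2 * τ - 1) = x := by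
        rw [← Real.rpow_add hx0, show 2 - 2 * τ + (2 * τ - 1) = 1 by ring, Real.rpow_one]
      have hp : 0 < x ^ (2 - 2 * τ) := by positivity
      rw [← mul_le_mul_iff_right₀ hp, Real.mul_rpow hq0.le hb0.le]
      calc x ^ (2 - 2 * τ) * ((q : ℝ) ^ (1 / k : ℝ) * |β| ^ (1 / k : ℝ)) ≤
            4 * A * (q : ℝ) ^ (-(1 / k) : ℝ) * (x * (3 * |β| ^ (-(1 / k) : ℝ))) *
              ((q : ℝ) ^ (1 / k : ℝ) * |β| ^ (1 / k : ℝ)) := by gcongr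
        _ = 12 * A * x * ((q : ℝ) ^ (1 / k : ℝ) * (q : ℝ) ^ (-(1 / k) : ℝ)) *
              (|β| ^ (1 / k : ℝ) * |β| ^ (-(1 / k) : ℝ)) := by ring
        _ = 12 * A * (x ^ (2 - 2 * τ) * x ^ (2 * τ - 1)) := by rw [hqinv, hbinv, e]; ring
        _ = _ := by ring
    rw [le_div_iff₀ hq0, mul_comm, show 2 * k * τ - k = k * (2 * τ - 1) by ring]
    exact hroot (by positivity) (by linarith) h

lemma sum_Icc_neg_natCast {M : Type*} [AddCommGroup M] (m : ℕ) (g : ℤ → M) :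
    ∑ x ∈ Finset.Icc (-(m : ℤ)) m, g x =
      ∑ x ∈ Finset.range (m + 1), g x + ∑ x ∈ Finset.range (m + 1), g (-x) - g 0 := by
  induction m with
  | zero => simp
  | succ m ih =>
    have e : Finset.Icc (-((m + 1 : ℕ) : ℤ)) (m + 1 : ℕ) =
        insert ((m + 1 : ℕ) : ℤ) (insert (-((m + 1 : ℕ) : ℤ)) (Finset.Icc (-(m : ℤ)) m)) := by
      ext x; simp only [Finset.mem_Icc, Finset.mem_insert]; omega
    rw [e, Finset.sum_insert (by simp only [Finset.mem_Icc, Finset.mem_insert]; omega),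
      Finset.sum_insert (by simp only [Finset.mem_Icc]; omega), ih,
      Finset.sum_range_succ _ (m + 1), Finset.sum_range_succ _ (m + 1)]
    abel

lemma norm_fW_le (k : ℕ) {P : ℝ} (hP : 0 ≤ P) (γ : ℝ) :
    ‖fW k P γ‖ ≤ 2 * ‖weylSum k (⌊P⌋₊ + 1) γ‖ + 1 := by
  have hfl : (⌊P⌋ : ℤ) = (⌊P⌋₊ : ℤ) := (Int.natCast_floor_eq_floor hP).symm
  rw [fW, hfl, sum_Icc_neg_natCast]
  have h2 : ‖∑ x ∈ Finset.range (⌊P⌋₊ + 1), eF (γ * ((-(x : ℤ) : ℤ) : ℝ) ^ k)‖ =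
      ‖weylSum k (⌊P⌋₊ + 1) γ‖ := by
    rcases Nat.even_or_odd k with h | h
    · simp [h.neg_pow, weylSum]
    · rw [← norm_weylSum_neg]
      simp [h.neg_pow, weylSum]
  refine (norm_sub_le _ _).trans ?_
  rw [norm_eF]
  refine add_le_add ((norm_add_le _ _).trans ?_) le_rfl
  rw [h2, two_mul]
  simp [weylSum]

lemma dlt_pos (k : ℕ) : 0 < dlt k := by unfold dlt; positivity

lemma dlt_eq (k : ℕ) : dlt k * (64 : ℝ) ^ k = 1 := by
  rw [dlt, pow_mul]; norm_num

lemma two_pow_mul_dlt_le (k : ℕ) (hk : 2 ≤ k) : 2 ^ k * dlt k ≤ 1 / 1024 := by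
  have h1 : (32 : ℝ) ^ 2 ≤ 32 ^ k := pow_le_pow_right₀ (by norm_num) hk
  have h2 : (64 : ℝ) ^ k = 32 ^ k * 2 ^ k := by rw [← mul_pow]; norm_num
  have h3 := dlt_eq k
  rw [h2] at h3
  have h4 := dlt_pos k
  have h5 : 0 < 2 ^ k * dlt k := by positivity
  nlinarith

lemma natCast_mul_dlt_le (k : ℕ) (hk : 2 ≤ k) : k * dlt k ≤ 1 / 1024 := by
  refine le_trans ?_ (two_pow_mul_dlt_le k hk)
  have : (k : ℝ) ≤ 2 ^ k := by exact_mod_cast Nat.lt_two_pow_self.le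
  have := dlt_pos k
  gcongr

lemma volume_setOf_abs_mul_sub_le {α : ℝ} (hα : 0 < α) (b r : ℝ) :
    volume {t : ℝ | |t * α - b| ≤ r} = ENNReal.ofReal (2 * (r / α)) := by
  rw [← Real.volume_closedBall (b / α)]
  congr 1
  ext t
  simp only [Set.mem_ofPred_eq, Metric.mem_closedBall, Real.dist_eq]
  rw [le_div_iff₀ hα, ← abs_of_pos hα, ← abs_mul, sub_mul, abs_of_pos hα, div_mul_cancel₀ _ hα.ne']

/-- The measure of the points of a bounded interval close, after dilation, to nonzero rationals. -/
lemma volume_setOf_near_rational_le {α M r : ℝ} (hα : 0 < α) (hM : 0 ≤ M) (hr : 0 ≤ r) (Q : ℕ) :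
    volume {t : ℝ | ∃ (q : ℕ) (a : ℤ), 0 < q ∧ q ≤ Q ∧ a ≠ 0 ∧ |(a : ℝ)| ≤ M * q * α ∧
      |t * α - a / q| ≤ r / q} ≤ ENNReal.ofReal (Q * (4 * M * r)) := by
  set S : ℕ → Finset ℤ := fun q ↦ (Finset.Icc (-(⌊M * q * α⌋₊ : ℤ)) ⌊M * q * α⌋₊).erase 0 with hS
  have hcard (q : ℕ) : ((S q).card : ℝ) ≤ 2 * (M * q * α) := by
    have h1 : (S q).card = 2 * ⌊M * q * α⌋₊ := by
      simp only [hS]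
      rw [Finset.card_erase_of_mem (by simp), Int.card_Icc]
      omega
    rw [h1]
    push_cast
    have := Nat.floor_le (show 0 ≤ M * q * α by positivity)
    linarith
  have hsub : {t : ℝ | ∃ (q : ℕ) (a : ℤ), 0 < q ∧ q ≤ Q ∧ a ≠ 0 ∧ |(a : ℝ)| ≤ M * q * α ∧
      |t * α - a / q| ≤ r / q} ⊆
      ⋃ q ∈ Finset.Icc 1 Q, ⋃ a ∈ S q, {t : ℝ | |t * α - a / q| ≤ r / q} := by
    rintro t ⟨q, a, hq, hqQ, ha, haM, ht⟩
    simp only [Set.mem_iUnion]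
    refine ⟨q, Finset.mem_Icc.2 ⟨hq, hqQ⟩, a, ?_, ht⟩
    have h1 : a.natAbs ≤ ⌊M * q * α⌋₊ := by
      refine Nat.le_floor ?_
      rwa [Nat.cast_natAbs, Int.cast_abs]
    simp only [hS, Finset.mem_erase, Finset.mem_Icc]
    exact ⟨ha, by omega, by omega⟩
  refine (measure_mono hsub).trans ((measure_biUnion_finset_le _ _).trans ?_)
  calc _ ≤ ∑ q ∈ Finset.Icc 1 Q, ENNReal.ofReal (4 * M * r) := by
        refine Finset.sum_le_sum fun q hq ↦ (measure_biUnion_finset_le _ _).trans ?_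
        have hq0 : (0 : ℝ) < q := by exact_mod_cast (Finset.mem_Icc.1 hq).1
        simp only [volume_setOf_abs_mul_sub_le hα]
        rw [Finset.sum_const, nsmul_eq_mul, ← ENNReal.ofReal_natCast,
          ← ENNReal.ofReal_mul (by positivity)]
        refine ENNReal.ofReal_le_ofReal ?_
        calc _ ≤ 2 * (M * q * α) * (2 * (r / q / α)) := by
              refine mul_le_mul_of_nonneg_right (hcard q) (by positivity)
          _ = _ := by field_simp; ring
    _ = _ := by
      rw [Finset.sum_const, Nat.card_Icc, Nat.add_sub_cancel, nsmul_eq_mul,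
        ← ENNReal.ofReal_natCast, ← ENNReal.ofReal_mul (by positivity)]

set_option maxHeartbeats 1000000 in
/-- The one-dimensional estimate behind the main theorem. -/
lemma exists_volume_large_fW_le (k : ℕ) (hk : 2 ≤ k) {C : ℝ} (hC : 2 ≤ C) :
    ∃ P₀ K : ℝ, 2 ≤ P₀ ∧ 0 < K ∧ ∀ P α : ℝ, P₀ ≤ P → P ^ ((1 : ℝ) / 3 - k) < α →
      volume {t : ℝ | 1 / C ≤ |t| ∧ |t| ≤ C ∧ P ^ (1 - 11 * dlt k) ≤ ‖fW k P (t * α)‖} ≤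
        ENNReal.ofReal (K * P ^ (48 * dlt k * k - k)) := by
  have hδ := dlt_pos k
  have hδk := natCast_mul_dlt_le k hk
  have hk0 : (0 : ℝ) < k := by positivity
  have hkR : (2 : ℝ) ≤ k := by exact_mod_cast hk
  set δ := dlt k with hδdef
  have hδ1 : δ ≤ 1 / 2048 := by nlinarith
  have hτ : 2 ^ (k - 1) * (12 * δ) ≤ 1 / 40 := by
    have h := two_pow_mul_dlt_le k hk
    rw [← hδdef, show k = k - 1 + 1 by omega, pow_succ] at h
    linarith
  obtain ⟨n₀, A, hA, H⟩ := exists_major_arc_of_weylSum_large k hk hτ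
  set η : ℝ := 2 * k * (12 * δ) with hη
  have hη0 : 0 ≤ η := by positivity
  have hη1 : η ≤ 1 / 4 := by linarith
  obtain ⟨P₁, hP₁⟩ := Filter.eventually_atTop.1
    ((tendsto_rpow_atTop hδ).eventually_ge_atTop 6)
  obtain ⟨P₂, hP₂⟩ := Filter.eventually_atTop.1
    ((tendsto_rpow_atTop (show (0 : ℝ) < 1 / 12 by norm_num)).eventually_gt_atTop (C * A))
  refine ⟨max 2 (max n₀ (max P₁ P₂)), A * 2 * (4 * (2 * C) * A), le_max_left _ _, by positivity,
    fun P α hP hα ↦ ?_⟩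
  simp only [max_le_iff] at hP
  obtain ⟨hP2, hPn, hP1', hP2'⟩ := hP
  have hP6 := hP₁ P hP1'
  have hPC := hP₂ P hP2'
  have hP0 : 0 < P := by linarith
  have hPone : 1 ≤ P := by linarith
  have hα0 : 0 < α := lt_of_le_of_lt (by positivity) hα
  set n := ⌊P⌋₊ + 1 with hn
  set x : ℝ := (n : ℝ) with hx
  have hPx : P ≤ x := by rw [hx, hn]; push_cast; exact (Nat.lt_floor_add_one P).le
  have hxP : x ≤ 2 * P := by
    have := Nat.floor_le hP0.le
    rw [hx, hn]; push_cast; linarith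
  have hx0 : 0 < x := by linarith
  have hx1 : 1 ≤ x := by linarith
  have hn₀ : n₀ ≤ n := by
    have : (n₀ : ℝ) ≤ n := hPn.trans hPx
    exact_mod_cast this
  set r : ℝ := A * x ^ (η - k) with hr
  have hr0 : 0 ≤ r := by positivity
  have hrP : r ≤ A * P ^ (η - k) := by
    rw [hr]
    refine mul_le_mul_of_nonneg_left ?_ (by linarith)
    exact Real.rpow_le_rpow_of_nonpos hP0 hPx (by linarith)
  have hrα : C * r < α := by
    calc C * r ≤ C * (A * P ^ (η - k)) := by gcongr
      _ = (C * A) * P ^ (η - k) := by ring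
      _ ≤ P ^ (1 / 12 : ℝ) * P ^ (η - k) := by gcongr
      _ = P ^ (1 / 12 + (η - k)) := by rw [← Real.rpow_add hP0]
      _ ≤ P ^ ((1 : ℝ) / 3 - k) := Real.rpow_le_rpow_of_exponent_le hPone (by linarith)
      _ < α := hα
  set Q : ℕ := ⌊A * x ^ η⌋₊ with hQ
  have hsub : {t : ℝ | 1 / C ≤ |t| ∧ |t| ≤ C ∧ P ^ (1 - 11 * δ) ≤ ‖fW k P (t * α)‖} ⊆
      {t : ℝ | ∃ (q : ℕ) (a : ℤ), 0 < q ∧ q ≤ Q ∧ a ≠ 0 ∧ |(a : ℝ)| ≤ (2 * C) * q * α ∧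
        |t * α - a / q| ≤ r / q} := by
    rintro t ⟨ht1, ht2, ht3⟩
    have hlarge : x ^ (1 - 12 * δ) ≤ ‖weylSum k n (t * α)‖ := by
      have h1 := ht3.trans (norm_fW_le k hP0.le (t * α))
      have h2 : x ^ (1 - 11 * δ) ≤ 2 * P ^ (1 - 11 * δ) := by
        calc x ^ (1 - 11 * δ) ≤ (2 * P) ^ (1 - 11 * δ) :=
              Real.rpow_le_rpow hx0.le hxP (by linarith)
          _ = 2 ^ (1 - 11 * δ) * P ^ (1 - 11 * δ) := Real.mul_rpow (by norm_num) hP0.le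
          _ ≤ 2 ^ (1 : ℝ) * P ^ (1 - 11 * δ) := by
              gcongr
              · norm_num
              · linarith
          _ = _ := by rw [Real.rpow_one]
      have h3 : x ^ (1 - 11 * δ) = x ^ (1 - 12 * δ) * x ^ δ := by
        rw [← Real.rpow_add hx0]; congr 1; ring
      have h4 : 6 ≤ x ^ δ := hP6.trans (Real.rpow_le_rpow hP0.le hPx hδ.le)
      have h5 : 1 ≤ x ^ (1 - 12 * δ) := Real.one_le_rpow hx1 (by linarith)
      rw [← hn] at h1
      nlinarith
    obtain ⟨q, a, hq, hqle, hdist⟩ := H n (t * α) hn₀ hlarge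
    have hq0 : (0 : ℝ) < q := by exact_mod_cast hq
    have hq1 : (1 : ℝ) ≤ q := by exact_mod_cast hq
    have hrq : r / q ≤ r := div_le_self hr0 hq1
    have hrlt : r < α / C := by
      rw [lt_div_iff₀ (by linarith)]; linarith
    have habs : |t * α| = |t| * α := by rw [abs_mul, abs_of_pos hα0]
    refine ⟨q, a, hq, Nat.le_floor hqle, ?_, ?_, hdist⟩
    · rintro rfl
      rw [Int.cast_zero, zero_div, sub_zero, habs] at hdist
      have : α / C ≤ |t| * α := by
        calc α / C = 1 / C * α := by ring
          _ ≤ _ := by gcongr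
      linarith
    · have h1 : |(a : ℝ) / q| ≤ 2 * C * α := by
        have h2 : |(a : ℝ) / q| ≤ |t * α| + |t * α - a / q| := by
          have := abs_sub (t * α) (t * α - a / q)
          rwa [sub_sub_cancel] at this
        have h3 : |t| * α ≤ C * α := by gcongr
        have h4 : α / C ≤ C * α := by
          calc α / C ≤ α := div_le_self hα0.le (by linarith)
            _ ≤ C * α := le_mul_of_one_le_left hα0.le (by linarith)
        rw [habs] at h2
        linarith
      rw [abs_div, abs_of_pos hq0, div_le_iff₀ hq0] at h1
      linarith
  refine (measure_mono hsub).trans ((volume_setOf_near_rational_le hα0 (by linarith) hr0 Q).trans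
    (ENNReal.ofReal_le_ofReal ?_))
  have hQx : (Q : ℝ) ≤ A * (2 * P ^ η) := by
    refine (Nat.floor_le (by positivity)).trans ?_
    gcongr
    calc x ^ η ≤ (2 * P) ^ η := Real.rpow_le_rpow hx0.le hxP hη0
      _ = 2 ^ η * P ^ η := Real.mul_rpow (by norm_num) hP0.le
      _ ≤ 2 ^ (1 : ℝ) * P ^ η := by
        gcongr
        · norm_num
        · linarith
      _ = _ := by rw [Real.rpow_one]
  calc Q * (4 * (2 * C) * r) ≤ A * (2 * P ^ η) * (4 * (2 * C) * (A * P ^ (η - k))) := by gcongr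
    _ = A * 2 * (4 * (2 * C) * A) * (P ^ η * P ^ (η - k)) := by ring
    _ = _ := by
      rw [← Real.rpow_add hP0, show η + (η - k) = 48 * δ * k - k by rw [hη]; ring]

/-- For k ≥ 2, s > 2k, C ≥ 2, δ = 8^{−2k}: the Lebesgue measure of
M_α(C) = {λ ∈ Λ_k^{(s)}(C) : |f(λ_j α)| ≥ P^{1−11δ} for all j} is
≪ P^{(55δk − k)(s−1)}, uniformly for P^{1/3−k} < α ≤ 1. -/
theorem stmt14 (k s : ℕ) (hk : 2 ≤ k) (hs : 2 * k < s) (C : ℝ) (hC : 2 ≤ C) :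
    ∃ c : ℝ, 0 < c ∧ ∀ P : ℝ, 2 ≤ P → ∀ α : ℝ, P ^ ((1 : ℝ) / 3 - k) < α → α ≤ 1 →
      volume {l : Fin s → ℝ | l ∈ LamC k s C ∧
          ∀ j, P ^ (1 - 11 * dlt k) ≤ ‖fW k P (l j * α)‖}
        ≤ ENNReal.ofReal (c * P ^ ((55 * dlt k * k - k) * ((s : ℝ) - 1))) := by
  obtain ⟨P₀, K, hP₀, hK, H⟩ := exists_volume_large_fW_le k hk hC
  have hδ := dlt_pos k
  have hδk := natCast_mul_dlt_le k hk
  have hkR : (2 : ℝ) ≤ k := by exact_mod_cast hk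
  have hs1 : (1 : ℝ) ≤ s := by exact_mod_cast (by omega : 1 ≤ s)
  set δ := dlt k with hδdef
  set e : ℝ := (55 * δ * k - k) * ((s : ℝ) - 1) with he
  have he0 : e ≤ 0 := mul_nonpos_of_nonpos_of_nonneg (by linarith) (by linarith)
  have hP₀0 : 0 < P₀ := by linarith
  refine ⟨K ^ s + (2 * C) ^ s * P₀ ^ (-e), by positivity, fun P hP α hα _ ↦ ?_⟩
  have hP0 : 0 < P := by linarith
  have hPe : 0 < P ^ e := by positivity
  have hpi (E : Set ℝ) {V : ℝ} (hV : 0 ≤ V) (hE : volume E ≤ ENNReal.ofReal V) :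
      volume (Set.univ.pi fun _ : Fin s ↦ E) ≤ ENNReal.ofReal (V ^ s) := by
    rw [volume_pi_pi, Finset.prod_const, Finset.card_univ, Fintype.card_fin,
      ENNReal.ofReal_pow hV]
    gcongr
  rcases le_total P₀ P with h | h
  · refine (measure_mono (t := Set.univ.pi fun _ : Fin s ↦ {t : ℝ | 1 / C ≤ |t| ∧ |t| ≤ C ∧
      P ^ (1 - 11 * δ) ≤ ‖fW k P (t * α)‖}) fun l hl j _ ↦
        ⟨(hl.1.2 j).1, (hl.1.2 j).2, hl.2 j⟩).trans ((hpi _ (by positivity) (H P α h hα)).trans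
        (ENNReal.ofReal_le_ofReal ?_))
    have h1 : (P ^ (48 * δ * k - k)) ^ s ≤ P ^ e := by
      rw [← Real.rpow_natCast, ← Real.rpow_mul hP0.le]
      refine Real.rpow_le_rpow_of_exponent_le (by linarith) ?_
      rw [he]
      have : 0 ≤ δ * k * s := by positivity
      nlinarith
    rw [mul_pow]
    calc K ^ s * (P ^ (48 * δ * k - k)) ^ s ≤ K ^ s * P ^ e := by gcongr
      _ ≤ _ := by
        gcongr
        have : 0 ≤ (2 * C) ^ s * P₀ ^ (-e) := by positivity
        linarith
  · refine (measure_mono (t := Set.univ.pi fun _ : Fin s ↦ Set.Icc (-C) C) fun l hl j _ ↦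
        abs_le.1 (hl.1.2 j).2).trans ((hpi _ (V := 2 * C) (by linarith) ?_).trans
        (ENNReal.ofReal_le_ofReal ?_))
    · rw [Real.volume_Icc, sub_neg_eq_add, two_mul]
    · have h1 : P₀ ^ e ≤ P ^ e := Real.rpow_le_rpow_of_nonpos hP0 h he0
      have h2 : P₀ ^ (-e) * P₀ ^ e = 1 := by rw [← Real.rpow_add hP₀0]; simp
      calc (2 * C) ^ s = (2 * C) ^ s * (P₀ ^ (-e) * P₀ ^ e) := by rw [h2, mul_one]
        _ ≤ (2 * C) ^ s * (P₀ ^ (-e) * P ^ e) := by gcongr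
        _ = (2 * C) ^ s * P₀ ^ (-e) * P ^ e := by ring
        _ ≤ _ := by
          gcongr
          have : 0 ≤ K ^ s := by positivity
          linarith
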